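/- arXiv:0810.3133 — 2 statements merged into one kernel-verified Lean document; each statement's English description precedes it below -/
import Mathlib

section
/- Every double-critical 7-chromatic graph contains K₇ as a minor. -/
open SimpleGraph

/-- A graph is vertex-critical if deleting any vertex decreases the chromatic number. -/
def VertexCritical {V : Type} (G : SimpleGraph V) : Prop :=
  ∀ v : V, (G.induce ({v}ᶜ : Set V)).chromaticNumber < G.chromaticNumber

/-- A vertex-critical graph is double-critical if deleting the two end-vertices of any
edge decreases the chromatic number by at least two. -/
def DoubleCritical {V : Type} (G : SimpleGraph V) : Prop :=
  VertexCritical G ∧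
  ∀ x y : V, G.Adj x y →
    (G.induce ({x, y}ᶜ : Set V)).chromaticNumber + 2 ≤ G.chromaticNumber


/-- `G` contains the complete graph `K_m` as a minor: there are `m` pairwise disjoint
non-empty subsets of the vertex set, each inducing a connected subgraph of `G`, with at
least one edge of `G` between every two of the subsets. -/
def HasCompleteMinor {V : Type} (G : SimpleGraph V) (m : ℕ) : Prop :=
  ∃ f : Fin m → Set V,
    (∀ i, (f i).Nonempty) ∧
    (∀ i, (G.induce (f i)).Connected) ∧
    (∀ i j, i ≠ j → Disjoint (f i) (f j)) ∧
    (∀ i j, i ≠ j → ∃ u ∈ f i, ∃ v ∈ f j, G.Adj u v)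

/-! ### A certificate checker for small neighbourhoods

A graph on `{0, …, n - 1}` in which every vertex has at most `D` non-neighbours is described by two
numbers, whose bit `16 * u + v` records that `u, v` are known to be adjacent, respectively known to
be non-adjacent. The additional vertex `n` is adjacent to every vertex having a non-neighbour. -/

namespace CliqueCert

/-- The entry `(u, v)` of the bit matrix `P`. -/
def has (P u v : ℕ) : Bool := P.testBit (16 * u + v)

/-- Set the entries `(u, v)` and `(v, u)` of the bit matrix `P`. -/
def put (P u v : ℕ) : ℕ := P ||| 1 <<< (16 * u + v) ||| 1 <<< (16 * v + u)

/-- The number of entries `u < k` in row `a`. -/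
def count (A a : ℕ) : ℕ → ℕ
  | 0 => 0
  | k + 1 => bif has A a k then count A a k + 1 else count A a k

/-- Make `a` adjacent to all `u < k` not recorded as non-neighbours of `a`. -/
def fill (A a : ℕ) (P : ℕ) : ℕ → ℕ
  | 0 => P
  | k + 1 => bif Nat.beq a k || has A a k then fill A a P k else fill A a (put P a k) k

/-- If all `D` possible non-neighbours of `a` are known, record its neighbours. -/
def saturate (n D A a P : ℕ) : ℕ :=
  bif Nat.beq (count A a n) D then fill A a P n else P

/-- The known adjacencies after `a` and `b` have become non-adjacent, leading to `A`. -/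
def exclude (n D A a b P : ℕ) : ℕ :=
  saturate n D A a (saturate n D A b (put (put P a n) b n))

/-- Decode a list of lists of naturals from base 16 digits: `0` separates the lists, and `v + 1`
stands for `v`. -/
def decode : ℕ → ℕ → List ℕ → List (List ℕ)
  | 0, _, l => [l]
  | k + 1, c, l =>
    match c % 16 with
    | 0 => bif Nat.beq c 0 then [l] else l :: decode k (c / 16) []
    | v + 1 => decode k (c / 16) (v :: l)

/-- Each vertex of the list, except the last one, is known to be adjacent to a later one. -/
def linked (n P : ℕ) : List ℕ → Bool
  | [] => false
  | v :: l =>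
    match l with
    | [] => Nat.ble v n
    | _ :: _ => Nat.ble v n && l.any (has P v) && linked n P l

/-- The two lists are disjoint and joined by a known adjacency. -/
def touch (P : ℕ) (l l' : List ℕ) : Bool :=
  l.any (fun v => l'.any (has P v)) && l.all (fun v => l'.all fun w => !Nat.beq v w)

/-- Any two members of the list touch. -/
def allTouch (P : ℕ) : List (List ℕ) → Bool
  | [] => true
  | l :: ls => ls.all (touch P l) && allTouch P ls

/-- The lists form a model of `K₆` in which each branch set meets `{0, …, n - 1}`. -/
def isModel (n P : ℕ) (ls : List (List ℕ)) : Bool :=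
  Nat.beq ls.length 6 && ls.all (fun l => linked n P l && l.any fun v => Nat.blt v n) &&
    allTouch P ls

/-- Run a decision tree, given in preorder. A token below `100` consists of two digits `a`, `b`, and
branches on whether `a` and `b` are adjacent; any other token encodes a model of `K₆`. -/
def run (n D : ℕ) : ℕ → ℕ → ℕ → List ℕ → Option (List ℕ)
  | 0, _, _, _ => none
  | _ + 1, _, _, [] => none
  | k + 1, P, A, t :: ts =>
    match Nat.blt t 100 with
    | true =>
      match run n D k (put P (t / 10) (t % 10)) A ts with
      | none => none
      | some ts' =>
        match Nat.blt (t / 10) n && Nat.blt (t % 10) n && !Nat.beq (t / 10) (t % 10) with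
        | true => run n D k (exclude n D (put A (t / 10) (t % 10)) (t / 10) (t % 10) P)
            (put A (t / 10) (t % 10)) ts'
        | false => none
    | false => bif isModel n P (decode 16 t []) then some ts else none

/-- The non-adjacencies between `0` and each of `1, …, k`. -/
def start : ℕ → ℕ
  | 0 => 0
  | k + 1 => put (start k) 0 (k + 1)

/-- The adjacencies of the vertex `n` in the initial state. -/
def startAdj (n : ℕ) : ℕ → ℕ
  | 0 => 0
  | k + 1 => put (put (startAdj n k) 0 n) (k + 1) n

/-- Saturate all vertices below `k`. -/
def saturateAll (n D A P : ℕ) : ℕ → ℕ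
  | 0 => P
  | k + 1 => saturate n D A k (saturateAll n D A P k)

/-- Check a certificate for graphs on `n` vertices in which `0` has the `D` non-neighbours
`1, …, D`, and no vertex has more. -/
def check (n D : ℕ) (ts : List ℕ) : Bool :=
  (run n D 40 (saturateAll n D (start D) (startAdj n D) n) (start D) ts).isSome

/-- Certificate for `6` vertices, the first of which has `0` non-neighbours. -/
def certSixZero : List ℕ :=
  [6618611909121]

/-- Certificate for `7` vertices, the first of which has `0` non-neighbours. -/
def certSevenZero : List ℕ :=
  [123558965555233]

/-- Certificate for `7` vertices, the first of which has `1` non-neighbours. -/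
def certSevenOne : List ℕ :=
  [23, 45, 26, 36, 24, 34, 46, 123489976590433, 1979465604276321, 1975857831747681,
   1975839712354401, 1976943519998001, 1976943518949441, 1697990627565681, 45, 1694364735643761,
   1976957612859441]

/-- Certificate for `8` vertices, the first of which has `0` non-neighbours. -/
def certEightZero : List ℕ :=
  [2259522249032481]

/-- Certificate for `8` vertices, the first of which has `1` non-neighbours. -/
def certEightOne : List ℕ :=
  [23, 24, 34, 25, 56, 57, 35, 45, 1694364648736881, 1697990627565681, 1694382855037041,
   2259910058319921, 1979534593237041, 1694364735643761, 25, 1694382855037041, 2258418479931441,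
   35, 1694364735643761, 2258418479931441, 45, 1694364735643761, 2258428294602801]

/-- Certificate for `8` vertices, the first of which has `2` non-neighbours. -/
def certEightTwo : List ℕ :=
  [13, 24, 15, 67, 35, 26, 17, 12, 27, 16, 34, 56, 57, 36152355798917265, 36152586616833345, 36,
   31690141402669185, 31690146687492225, 45, 36, 37, 36152219665565265, 36152578026899025,
   36152578026899025, 36152286726100545, 36, 57, 23, 36152371868934225, 2258428025118801,
   36152586616971345, 34, 31613794027708545, 2259909788835921, 47, 34, 45, 1694364649136241,
   36193745358569985, 14, 36117393724940385, 36152288385310785, 36134626942650705, 34, 45,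
   1694364649136241, 27185442227495025, 45, 27110194400469105, 2259517920649281, 27, 37, 56, 23,
   36152371868934225, 1976957343375441, 36152586616971345, 34, 36117393655079025,
   1979534323753041, 2375358509752401, 46, 16, 34, 45, 1694364649070721, 31690145747976705, 14,
   31613794114347105, 36152288385310785, 2375358509752401, 31631027583715665, 34, 36, 27, 25,
   16, 46, 45, 31613435753030145, 12, 31690145677910145, 2259522215551041, 23,
   31689041941389825, 31689041941373025, 23, 38009430854344785, 36152218592288865, 14,
   27110057048023185, 2259522251923521, 16, 42791910271747665, 31690141366493265, 14, 16, 12,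
   26, 31690159572394065, 2375289790275681, 36152578027167825, 38009430854344785, 27,
   36194840505091665, 36152582341664865, 16, 57, 26, 14, 31672549283733585, 2259517940195841,
   36152586633683025, 14, 42791918881480785, 2259517940195841, 26, 31690141366493265,
   2259909788835921, 36, 37, 26, 16, 12, 25, 27, 34, 42791910308323425, 31689041941373025,
   42791910271747665, 42791910271747665, 36194840505360465, 23, 42791910272016465, 34,
   1975839712371201, 1976939223994881, 42791910308323425, 56, 25, 12, 36194849095025985,
   36194849095229505, 42791910272016465, 23, 31690141366493265, 2258419435184241, 57, 12, 17,
   23, 27, 14, 36158579122643025, 36158579391078465, 1976957611810881, 2258414150361201,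
   31672553475017025, 36194849095229505, 23, 36193740993798225, 1976944458473601, 23, 56, 37,
   25, 45, 47, 35, 27110125680926865, 2258418428572161, 42790815055421505, 27, 2258414114119761,
   36134990155641345, 2259909788835921, 25, 35, 42790810760454225, 42792306435170385,
   36158579122643025, 34, 27109834386180465, 42509340078776385, 46, 34, 36, 31613435666106465,
   31690146687492225, 31613794027440225, 35, 34, 42508236325134465, 2257324218523761,
   36134985841188945, 15, 46, 37, 14, 45, 57, 34, 27110125750722705, 2258418478891521,
   42790815125217345, 17, 2257314672287841, 36193745358569985, 2259841069359201, 14, 34,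
   42789711318622305, 42792237715693665, 36157479611015265, 35, 27109835770300785,
   42509340165283905, 36, 34, 46, 31613435666106465, 31690146687492225, 31689041854466145, 45,
   34, 42508236325134465, 2258741557731441, 36134990136156225, 24, 25, 36, 47, 23, 35, 57, 34,
   27167850041385105, 2258414150382081, 42790810760454225, 27, 2257314602492001,
   36193741030060545, 2257328513491041, 23, 34, 42789711248826465, 42789725159825505,
   36192655393169505, 45, 27109834386180465, 42509335783809105, 46, 34, 36, 31613434014599265,
   31690146687492225, 31613794027440225, 35, 34, 42508236272050305, 2257324218523761,
   36193740993798225, 56, 35, 36, 31631026200643665, 31631386213484625, 31631386213484625, 34,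
   35, 42509335783612545, 2258419435184241, 36192641482170465]

/-- Certificate for `9` vertices, the first of which has `0` non-neighbours. -/
def certNineZero : List ℕ :=
  [40673616786899745]

/-- Certificate for `9` vertices, the first of which has `1` non-neighbours. -/
def certNineOne : List ℕ :=
  [23, 45, 67, 28, 34, 36, 24, 56, 25, 27110056961116545, 36152357104518465, 31690145677902465,
   36152288385041985, 31631096588404785, 36152288401819185, 40673616832103745,
   36194849128580145, 27185442227095665, 45, 27109836038735985, 40638521060493105]

/-- Certificate for `9` vertices, the first of which has `2` non-neighbours. -/
def certNineTwo : List ℕ :=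
  [13, 24, 16, 36, 25, 27, 28, 12, 45, 14, 15, 37, 38, 46, 56, 506097525330152065,
   752207035291965505, 34, 752189376045385825, 752189734406719585, 68, 46, 761231759440355425,
   507306146394021985, 40638294167422785, 38, 67, 46, 756728160081420385, 507306146394021985,
   36134694540056385, 27109834379794545, 35, 46, 23, 433760911386347905, 31613587869010305,
   752207035294157185, 34, 433764209920182385, 40679748434790225, 34, 56, 23,
   433760911386347905, 31631111335577985, 752207035294157185, 35, 433764209920182385,
   40678648923162465, 47, 57, 14, 37, 579381399593814385, 15, 578160872968554865,
   579381399591622465, 578160941684791105, 34, 756710651342227825, 756710793092924305, 35,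
   756693127875660145, 756734501312398225, 45, 34, 35, 27109834387228785, 433764209920182385,
   35, 433764209920182385, 433764209920182385, 34, 35, 435248550617679985, 506103278934820945,
   505821803958110305, 48, 58, 78, 18, 34, 46, 31613434014599265, 651456587206238305, 14,
   649936993417037665, 40673479393484865, 42791910271747665, 650493095802087505,
   650493104392021585, 650493104392021585, 47, 57, 78, 17, 34, 46, 31613434013550945,
   579398993436745825, 14, 577879399647545185, 40673479393484865, 42791910271747665,
   578435501764159825, 578435514649060945, 578435514649060945, 45, 57, 58, 15, 34, 46,
   31613434011453825, 752207036951044225, 14, 433764211571689585, 40638295558266945,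
   31690141366093905, 506096441339455825, 506096445634422865, 506096445634422865, 25, 34, 14,
   26, 47, 18, 67, 12, 506743623434504545, 578442433084858465, 12, 756728227105379905,
   579398991785100865, 46, 761231843155642465, 761232053609039425, 23, 756692974019152225,
   756692975672756065, 15, 752189374386444385, 507323822080270465, 23, 47, 752189374392830305,
   756692974021248865, 45, 752189376045654145, 40620634652745825, 47, 18, 12, 14,
   752189665687243105, 752264982233745505, 577879397996037985, 761196864941983585, 12,
   756693334034089825, 40620787124150385, 45, 17, 35, 14, 752212205675612545,
   752206967157688705, 36193740993464145, 34, 756715805302983025, 756710635236100465,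
   506103349305804865, 36, 57, 25, 46, 47, 37, 577876101434450065, 579398992631302465, 23,
   756693196595136865, 756728227107572065, 27, 36152355453011265, 578437717974713665, 34, 35,
   752206967962995025, 27110057064800385, 35, 752206967962995025, 40679748434790225, 25, 56, 23,
   756710788781181265, 756728295827048785, 756770789474305345, 756728297483935825, 35, 47, 25,
   506103278934820945, 36152286733534785, 23, 756728227112814145, 40656108935061585,
   680226079893489745, 45, 67, 16, 34, 37, 46, 505819605781586065, 36117035293810785, 14,
   756692974867450225, 36152582321866305, 17, 36152288385041985, 578436614169167425, 35, 34,
   433757380914747505, 578436614169167425, 34, 752207035608729985, 36152582338708065, 16, 46,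
   14, 756728227959015745, 579399287373432385, 756728522701145665, 756728227959480385, 56, 37,
   16, 507323807212636225, 36117035293476705, 15, 756710793076148545, 40638521044049985,
   752207330887731265, 23, 45, 24, 35, 26, 34, 25, 433757350212442225, 36, 433757380920084865,
   752206967158153345, 56, 31631026778873985, 752207035608729985, 34, 433757350212442225,
   752189528248289665, 26, 747685774766508145, 752207051714857345, 36, 57, 35,
   435248550615583105, 36134710962948465, 34, 756710635236100465, 40678648923496545,
   752189375240544385, 24, 36, 27, 34, 747685774764411265, 577878298476980065, 34,
   756692974019152225, 40620924562704225, 25, 752206966579923025, 40638226570420305, 36,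
   505814970666190945, 40620634384375905, 45, 27110194400069745, 435248910630520945]

/-- Certificate for `9` vertices, the first of which has `3` non-neighbours. -/
def certNineThree : List ℕ :=
  [45, 16, 27, 38, 14, 56, 24, 57, 34, 35, 12, 433764211303587985, 13, 433757382305587345,
   433764211303254385, 36, 23, 433760912768901265, 433762012817203345, 433762012817203345, 35,
   36, 67, 506103280318095505, 13, 756728296094638225, 579399060766924945, 752207036682608785,
   17, 578536907869391185, 578157575016161425, 35, 12, 48, 47, 25, 433764569933357185, 23,
   756710636595393025, 756710636595393025, 17, 37, 433763112328917505, 578537266082763265,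
   608092138637382145, 28, 756710635339805185, 23, 761214234863804545, 761196727503364225, 13,
   23, 756710566785392785, 756710926220468305, 23, 756710926256709745, 31631027852550225, 34,
   25, 13, 15, 23, 47, 756710635236100465, 756710635236100465, 433760912768901265,
   756710926256730625, 433760911386347905, 13, 756710926256709745, 756710926256730625, 25,
   756710635236434065, 756710636598075505, 25, 37, 58, 12, 36, 435248910717448705, 13,
   752207326679683585, 752207035561544065, 13, 435248910630854785, 650213398185255025, 68, 26,
   23, 28, 35, 650495543941924945, 13, 650500079421098065, 650500079688385105,
   761231895455466625, 761231895455466625, 506103280586530945, 23, 28, 48, 12,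
   433764211572023425, 506103278935023745, 34, 651456517100609665, 506097549711057025,
   761231895455466625, 761231895455466625, 34, 13, 23, 756692974867783825, 31631386213687425,
   756692974867783825, 12, 435248550615583105, 506096419230321025, 36, 57, 506103280318095505,
   15, 35, 46, 756710636058182545, 756728296094435665, 756710788884865105, 756710788884877825,
   37, 13, 47, 747743790420330865, 46, 17, 579398923058189905, 57, 506097549715906705,
   578442485383170385, 747685776418015345, 15, 752207035561544065, 507306298510483585,
   756710635193107345, 25, 15, 48, 47, 13, 58, 433763112415404145, 35, 433763112415404145, 23,
   761214235937349745, 761214235937349745, 12, 433764570019930225, 433764570019930225, 78, 13,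
   23, 756710636598075505, 12, 433764211658596465, 756710634924672145, 12, 433764211658596465,
   650781417595215985, 17, 24, 433764211303254385, 23, 752207036970729985, 756710635339784305,
   578155735547933185, 34, 37, 18, 752207035695665665, 12, 761214234950377585,
   761214234950377585, 23, 13, 761214234863470705, 761214234820477825, 761214234815117425, 24,
   13, 23, 761214234548897905, 761214235937349745, 761214234549231745, 12, 433764211303254385,
   761231828143071745, 35, 12, 13, 17, 18, 24, 46, 752207035294157185, 752207035294157185, 23,
   752206966575729025, 752207326592966785, 24, 46, 761214392703656065, 761214234548897905, 23,
   752206966575729025, 752207326592966785, 24, 46, 752207035294157185, 752207035294157185, 23,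
   752206966575729025, 756710926220337265, 23, 752207326592966785, 752206967963197585, 23,
   752206967963197585, 752207326592966785, 13, 12, 23, 752207326592966785, 752207326679683585,
   23, 752207326679683585, 40679748504920145, 579099855900772945, 24, 57, 35, 23, 12, 15, 34,
   752206967963197585, 433764211303254385, 13, 752206967963197585, 752248512060596305, 13,
   752206967963197585, 752207326679670865, 13, 752207326679683585, 507323738493362305, 13, 23,
   752207326679683585, 27110194486976625, 752207326679683585, 23, 47, 12, 756710635236100465,
   756710635236434065, 12, 756710635236100465, 756710635236434065, 13, 756710926256709745,
   27109836039069825, 15, 35, 34, 752207035561544065, 48, 752207036967755905,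
   761231828123255905, 13, 752207326679670865, 752207036967755905, 13, 752206967963197585,
   650876403696404305, 17, 13, 12, 18, 28, 48, 35, 46, 649932595907731585, 24, 68,
   651456586686079105, 651456586686079105, 649930163034916705, 23, 36, 651421332724025185,
   651421332724025185, 651421334114535265, 46, 37, 24, 25, 651421624024827745,
   651439216210872145, 577872568995940705, 35, 24, 651474263180583025, 23, 761249419235893345,
   31613434861199505, 651438924910069585, 651456602238486625, 36, 25, 68, 26, 48,
   650499942618505345, 34, 650493112981947985, 761231826739273825, 650500010967860065, 58, 23,
   651421333577664625, 651421555358703745, 23, 651438926300579665, 651439147527970945, 46,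
   507306144648173665, 507323736834218065, 26, 34, 78, 37, 650774587958654545,
   650781485992904545, 23, 35, 46, 761231843155642465, 47, 761249435341686625,
   651474178271217505, 761249350199309905, 761249351052953425, 46, 761231852772008065,
   36192641481836385, 56, 34, 761238100923129985, 761238096628025425, 650500080023904385, 25,
   36, 26, 46, 761219418841686145, 24, 34, 761231843155642465, 23, 507306144648173665,
   36117393724957185, 761231843242549345, 23, 46, 761231916189884545, 34, 761219404930353265,
   752189734407118945, 34, 752189734406987905, 761219405017260145, 23, 34, 752212205675612545,
   761219404930353265, 435248552000751985, 26, 46, 23, 35, 761214392723316865, 34,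
   747726198234286465, 761236997116397665, 34, 747686134779682945, 31636265400017025, 23, 24,
   34, 752189374390733185, 752189734406987905, 651456586090480225, 34, 752189734406987905,
   36117393655079025, 36, 46, 761231827049783425, 34, 761196573645473905, 651456585820020865,
   34, 752189374390733185, 761214166412429425, 25, 23, 24, 35, 435248552000751985, 36, 46,
   433764211303587985, 34, 752207035294157185, 36192641535189105, 752207035294157185, 46, 35,
   435248550616631665, 434404554420330625, 650858382775945825, 36, 46, 507306504668848225,
   507306504668848225, 752189376045654145, 48, 649936992033185905, 34, 651438924916459345, 35,
   761214234863870065, 36117256319558145, 35, 23, 24, 57, 435248910717427825,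
   756710926256709745, 26, 46, 57, 435248910717427825, 756710793095946385, 752189375777415265,
   752212228176879745, 26, 46, 507306146039144545, 507306146039144545, 752189376045654145, 47,
   577872568998305905, 24, 579381330879579985, 25, 756710635236565105, 40620924632850945, 35,
   26, 36, 46, 756715805373112465, 24, 756728159276114065, 23, 507306144648173665,
   40620855930151425, 23, 46, 756728316562514065, 24, 756715805302983025, 752189375777415265,
   24, 752189375777218705, 756715827804250225, 23, 24, 752212205675612545, 756715805302983025,
   435248910630520945, 36, 46, 23, 25, 756710793095946385, 24, 747726198234286465,
   756733397489027425, 24, 747685776149913745, 31636265383239825, 23, 34, 24,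
   752189374390733185, 752189375777218705, 579398993453449825, 24, 752189375777218705,
   40620634652680305, 26, 46, 756728227422412945, 24, 756692974018103665, 579398992050462865,
   24, 752189374390733185, 756710651342227825, 34, 58, 18, 13, 56, 28, 57, 26,
   650218552232538625, 12, 651456655925789185, 651456654538449025, 23, 651474247326134785, 24,
   651474247306453105, 31631027584180305, 12, 23, 24, 37, 761219404930687105,
   756769681409319025, 761214250969931905, 31631027584180305, 761214250969931905, 28, 48, 23,
   14, 651438993946314865, 12, 651439010052442225, 651456655074132865, 12, 651439010139349105,
   40638294173950065, 23, 35, 14, 752207035567833985, 12, 651421486585874545,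
   651456654851835985, 25, 651456654538449025, 651456655925715025, 12, 651421486672781425,
   761214234821591665, 23, 12, 48, 46, 25, 651456655074205825, 507323805555886465, 24, 35,
   651456655074132865, 752189374393878625, 651456655074205825, 25, 651456655925789185,
   650500080809411665, 14, 433764209920516225, 761214234548897905, 507323738224724305, 14, 24,
   675628182648856705, 675628182648856705, 46, 761214234820477825, 24, 761214234816284785,
   651456586686411265, 14, 28, 48, 56, 23, 35, 650212711755882625, 650212724949262465,
   761214234820477825, 12, 35, 23, 651456654852038785, 651456654938755585, 747685776418015345,
   651456655137145345, 12, 13, 37, 650295724238467585, 756769685684559985, 761214234820477825,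
   24, 650295861643866625, 650218535729242225, 25, 12, 649936992880500865, 42790815055224945,
   651438995039875585, 23, 36, 28, 47, 761196575031959665, 756715805406666865,
   649933695419293825, 28, 752266081745373265, 651456587223151105, 24, 761214234816284785,
   761214167217735505, 18, 28, 48, 13, 23, 14, 651438993946314865, 12, 651439010052442225,
   651439010139349105, 12, 651439010139349105, 761214234821591665, 12, 651439010052776065,
   761214234820477825, 36, 14, 23, 56, 650500079735873665, 650500079735873665, 12,
   651439147578302545, 40656108934996065, 15, 47, 650858605472408065, 651474331900076545, 25,
   23, 651439147491395665, 650781416956655185, 761231895727120465, 67, 650777886495737425, 26,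
   650781554397808465, 761231895991288705, 23, 12, 13, 651439010139349105, 651439010139369985,
   13, 651438995020193905, 36194840505360465, 761214234821591665, 13, 12, 23,
   651439010052776065, 651439010139369985, 23, 651438993946648705, 36194840558444625,
   761214234820477825, 15, 28, 17, 47, 761219405017260145, 14, 24, 761249350784517985, 12,
   579363738686101345, 31613587972719105, 761249350784852065, 12, 47, 761249508372979825, 24,
   761219404930353265, 756693196698820705, 24, 756693127979343985, 756715805303447665, 12, 24,
   761219404930353265, 761219404930353265, 761219404930687105, 12, 17, 47, 14,
   761196727589937265, 46, 578519315683346785, 577874999949527665, 14, 24, 761249350199309905,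
   25, 761214235685625985, 31613587972694145, 761249350199309905, 26, 46, 507306144648173665,
   761231758013269585, 24, 761196727503030385, 761214165830469745, 24, 761196727589937265,
   761214165833818225, 28, 24, 34, 57, 12, 23, 26, 38, 14, 13, 756715805302983025, 15, 17, 18,
   756715827804250225, 25, 761255694135468145, 36, 756715805303316625, 761249487909946225,
   756715827804250225, 756715827804250225, 13, 15, 756692974018103665, 46, 756692974019152225,
   752189374391132305, 756693334034358385, 35, 47, 14, 13, 761254589302441825,
   756692974019152225, 15, 36, 761255693125886065, 761249419191518065, 761249488177333105, 37,
   15, 761196573645473905, 13, 14, 761196573641181025, 46, 756692974019152225,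
   651474178003830625, 761249487909946225, 761255693125886065, 14, 761219404930353265, 15,
   761214235954061425, 761249508372979825, 14, 13, 36, 756715805302983025, 56,
   756710651342561425, 506760857544499345, 15, 756710651342227825, 752207051715256465, 15, 17,
   18, 37, 579399081234800785, 13, 756710634921527665, 756710635188818545, 756710634921527665,
   756710634921527665, 752207035298488465, 14, 13, 38, 756715827804250225, 756710788781383825,
   756710567859003505, 36, 35, 756710636058255505, 433762012548964465, 756710635195269745, 14,
   15, 756710651342561425, 433764209920581745, 756710634921527665, 37, 17, 47, 67, 15, 26,
   577879399110942865, 752207051715256465, 12, 36, 579381400730542225, 38, 579381401267413105,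
   761249350784517985, 579381399865459345, 12, 13, 579381401250701425, 14, 579381416118198385,
   579399008304259585, 13, 579381399867556465, 579381399908851825, 12, 15, 36,
   579381416118219265, 579399008304259585, 13, 579381416118198385, 579381416118198385, 13,
   579381332531421265, 756710635236565105, 13, 12, 579381401250701425, 579381399867556465,
   579381416118219265, 13, 12, 579381401250701425, 579381401250701425, 579381401250722305, 35,
   23, 12, 13, 36, 15, 756715805302983025, 17, 18, 46, 756733397489027425, 14,
   756693127875660145, 752189528248688785, 756693127875660145, 756693127875660145, 17, 46,
   756693127875993745, 14, 756693127875660145, 579398992648151185, 14, 756693127875660145,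
   756715805302983025, 14, 756693127875993745, 756715805303316625, 17, 15, 37,
   435248841911378065, 756715805303316625, 756710634921527665, 756693127876124785, 14,
   756693127875660145, 15, 756715805406666865, 46, 756710636058247825, 40678648976515185, 58,
   18, 12, 651438924910069585, 651438924915411025, 15, 651474247306453105, 56,
   651474247860171265, 651456655942419025, 25, 15, 14, 756710634921527665, 46,
   756710634924810385, 651456587222942305, 12, 761214457128362065, 31631317494210705,
   761214457164603505, 35, 48, 17, 46, 36, 756693127979364865, 13, 756728228764598785, 14,
   505821805609617505, 40661056737517665, 14, 36, 756728312247951505, 13, 756693127979343985,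
   752189376045785185, 13, 752189376045785185, 756768591477481585, 14, 13, 756693127979343985,
   756693127979343985, 756768591477481585, 46, 15, 37, 34, 761196574763524225,
   761196865012130305, 17, 434404554419865985, 578155143752713105, 17, 14, 36,
   761214235685625985, 761231827606184065, 761214234820543105, 756710636041543825, 56,
   756728312247951505, 15, 761214234863470705, 36, 761214234816284785, 37, 761249419192639585,
   756710635188914545, 37, 36, 13, 46, 15, 507306144648173665, 17, 507306144648173665,
   507306144648173665, 14, 507323736834218065, 15, 756710636578414705, 579398992053535585, 14,
   756692974867783825, 756710651342692465, 17, 46, 756728227959152785, 14, 756692974867450225,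
   579398992050462865, 14, 756692974867450225, 756710651342227825, 17, 46, 507306144648173665,
   507323736834218065, 578155139501269105, 37, 48, 15, 35, 13, 761219404930353265, 14,
   761196727503030385, 756693127876124785, 34, 13, 761214234548897905, 14, 761214234546701425,
   651474178271217505, 756710634926907505, 13, 14, 35, 761214234548897905, 34,
   761196573641181025, 756693334034089825, 35, 756710634926907505, 34, 747685774766508145,
   651474109867362145, 34, 761196864941983585, 756710636595118705, 58, 38, 18, 14,
   651474267458773105, 13, 651421333577664625, 651474267458773105, 13, 651421333577998465,
   761214234546686065, 13, 651421624078180465, 761214234816184945, 67, 650777860732225105, 17,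
   650781554712381265, 761249488177398385, 38, 47, 13, 57, 17, 34, 761249435395039345,
   761249419789279345, 34, 761249435395060225, 761249419789545985, 579381690928996465, 14,
   761254589302775905, 27109834387628145, 13, 579364098759729265, 761255693125878385, 47, 15,
   761254589302710385, 761214461439836785, 761255693125878385, 17, 28, 14, 34, 56, 12, 13, 18,
   37, 24, 23, 752212205675612545, 25, 26, 15, 752207051714857345, 36, 506097781377730945,
   752206968231633025, 752212223881912465, 752212223881912465, 23, 25, 752189375240079745, 47,
   577872552932805265, 579398923058189905, 752189665740595345, 35, 46, 24, 23,
   756733397489027425, 752189376045385825, 25, 36, 756728227378168465, 756734501312471185,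
   756728296363983505, 36, 25, 756692974867450225, 23, 24, 756692974013814625, 47,
   579398992094431585, 752189376045385825, 756728296096596625, 756734501312471185, 24,
   756715805302983025, 25, 756710636058255505, 756728316559564945, 24, 23, 37,
   752212205675612545, 35, 46, 752207035560376705, 756734501312398225, 761214388445126785, 25,
   752207051714857345, 761214251039727745, 25, 26, 27, 36, 761231916170223745, 23,
   761238100942790785, 761238100939768705, 752207035608729985, 761238100942790785,
   761214235688575105, 24, 23, 37, 752212223881912465, 752207326629339265, 752206967158153345,
   37, 35, 752207036699247505, 433760913305706625, 756734501312471185, 24, 25,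
   752207051818541185, 433764211035283585, 752207035608729985, 36, 26, 46, 68, 25, 18,
   505821804804776065, 761214251039727745, 12, 38, 507323807229485185, 37, 507323806961049745,
   756728158389143905, 507323805823177345, 12, 23, 507323805870858385, 24, 507323821976985745,
   761231843209019905, 23, 507323805828514705, 507323805561266305, 12, 13, 15, 35,
   433757380914747505, 23, 507323736840603985, 507323738493558865, 57, 506760872143655425,
   756710635195204465, 23, 507323821976985745, 752207035566785425, 23, 507323738493558865,
   752207035299537025, 23, 12, 507323805870858385, 507323805829628545, 507323822080295425, 23,
   12, 507323805870858385, 507323805870858385, 507323805974168065, 35, 13, 12, 23, 36, 37, 15,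
   18, 26, 48, 752189528351973505, 24, 761196727503030385, 761231828140105825, 24,
   752189528248289665, 752212205675612545, 26, 46, 761231827603234945, 24, 761196727503030385,
   752189665790926945, 24, 752189528248289665, 761219404930353265, 26, 46, 507323736837458305,
   24, 752189528248289665, 752189528351973505, 24, 752189528248289665, 752206966575729025, 25,
   752212205675612545, 24, 752189528248289665, 46, 756728227975864465, 579398993436607585, 26,
   46, 48, 752189528351973505, 761196727573160065, 507306298510418065, 505817407831941265, 24,
   752189528351973505, 752212205779296385, 26, 25, 36, 435248773295251585, 752212205779296385,
   752207035608729985, 752189528248754305, 24, 752189528248289665, 25, 752212205676011665, 46,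
   507323736841855105, 40678648923431025, 57, 27, 12, 579381330872145745, 579381332531087185,
   25, 579399060814110865, 56, 578537338993582225, 579399062172861265, 15, 25, 24,
   756710634921527665, 48, 756710636578414705, 761249420057641825, 12, 756710788884865105,
   40662156248948865, 650215168471599745, 35, 47, 26, 48, 38, 649932595907797105, 23,
   651456586689053185, 24, 649936992032917345, 36192641551966305, 24, 36, 761196727573185025,
   23, 761196727503429745, 651456517681317985, 23, 761196574763655265, 761196727573185025, 24,
   23, 752189528248688785, 752189528248688785, 752247399664066705, 48, 25, 36, 34,
   756692974867914865, 756693196648518145, 26, 434967504373287025, 506097549716947585, 26, 24,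
   38, 756710636595126385, 651474178006065265, 756710635195204465, 752207035609194625, 58,
   651456670994538625, 25, 756710634921527665, 36, 761214234816284785, 37, 761214234816284785,
   756710635188914545, 36, 38, 23, 48, 25, 651421332724025185, 26, 651421332724025185,
   651421332724025185, 24, 651438924910069585, 25, 761214234863870065, 761231827007636065, 24,
   752189376045654145, 752207051818541185, 26, 46, 761231827005546625, 24, 761196573645473905,
   651456586132627585, 24, 752189374390733185, 761214250969598065, 26, 48, 651421332724025185,
   651438924910069585, 506097549448585345, 12, 26, 14, 25, 34, 58, 15, 23, 761214250969598065,
   761214250969598065, 24, 433764209920182385, 752207035609194625, 18, 38, 24, 13, 15,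
   761214250969598065, 27, 35, 46, 752207035561544065, 752207035561544065, 761214250969997425,
   756715805302983025, 761214250969598065, 752189734460072065, 649936993201954945,
   649936993201979905, 38, 23, 13, 57, 35, 435248550616631665, 761255688814069585, 24, 18, 35,
   761214234548897905, 15, 761214234546701425, 756728297500639825, 756710634919315825, 35,
   756710566203099505, 761249350199309905, 761219404930752625, 761196727503030385,
   761219404930353265, 34, 13, 15, 56, 761214251039727745, 36, 761219404930353265, 35,
   761214392720294785, 36194840505360465, 57, 603571015422970225, 756710567322394705, 37,
   747686066059872625, 756710566785523825, 35, 13, 761196727503030385, 761214234863470705, 56,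
   761231916170223745, 761214235937211505, 37, 23, 24, 35, 761219404930353265, 34,
   761196573645473905, 47, 761254589302441825, 756728228781163105, 34, 761219404930353265,
   577879399111139425, 34, 761196864942252145, 761219405000482945, 23, 38, 34, 24,
   756692974018103665, 756715805302983025, 24, 761219404930353265, 27110194470224385, 24,
   761196573645473905, 761219404930353265, 756692975136153745, 36, 13, 14, 48, 46,
   761196796222507105, 761238100923129985, 46, 761196796222507105, 761238100923129985, 46,
   761196796222775425, 506103349037506705, 34, 35, 433757350212442225, 761214250969598065,
   761196727503030385, 34, 13, 761231843209019905, 38005740467847825, 761231827603567105, 34,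
   35, 433757350178892145, 761214250969997425, 35, 761196727503429745, 761214234553091185, 34,
   35, 38, 24, 25, 433757380914747505, 756710566785059185, 25, 756692974867450225,
   756710635187770225, 36, 24, 25, 433757380914747505, 756710566785059185, 25,
   756692974867450225, 761214234815136625, 46, 25, 752189375240079745, 752207035561544065,
   752207035561544065, 26, 23, 36, 24, 756715805302983025, 27, 28, 47, 747685776149580145, 57,
   752207036702269585, 578442485650461265, 756710635236100465, 756710635236100465, 46,
   756715805373112465, 756728296429883905, 24, 756715805373112465, 756710635306229905, 27, 25,
   23, 752207051714857345, 756710651342227825, 36, 756715805302983025, 40680847946686545,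
   756710651342227825, 35, 26, 23, 36, 25, 756715805302983025, 27, 28, 46, 756710636058182545,
   24, 756710635236100465, 752207036702269585, 756710635236100465, 756710635236100465, 46,
   756693127945789585, 506103349054218385, 24, 756693127945789585, 756715805373112465, 27, 24,
   23, 752189528248289665, 756693127875660145, 36, 756715805302983025, 40662156248746065,
   756693127875660145, 24, 56, 756710636061204625, 25, 756710634919335025, 752207036702269585,
   46, 25, 756710636061204625, 756728158389143905, 25, 752207036702269585, 40678648923162465,
   16, 27, 38, 14, 15, 24, 26, 37, 48, 12, 17, 747686152985649265, 13, 747686134866255985,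
   747686134866255985, 13, 747686134866276865, 747686134866255985, 34, 17, 761196865012113505,
   13, 761196865012113505, 747686134866255985, 13, 761196865012113505, 761196865012130305, 13,
   23, 34, 756692975135885665, 56, 756710567321930065, 507323736837458305, 756692975135885665,
   756692975136153745, 12, 23, 35, 25, 34, 752206966575729025, 13, 752206966572488785,
   435248550615583105, 48, 752189734406987905, 34, 752189374390733185, 36, 761231827049515105,
   752189665687243105, 13, 57, 34, 752189374386444385, 752248489559329105, 756710926220134225,
   747685774764411265, 34, 13, 752189734406719585, 752206968231633025, 752206968231430225, 34,
   13, 752189374390733185, 752189734407118945, 13, 36, 48, 752189734406987905,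
   761231827049515105, 752206966575729025, 752206966579923025, 34, 46, 67, 12, 68, 47,
   505822164057858145, 23, 756728228781170785, 650494205847871585, 25, 26, 28, 17,
   507323805974143105, 756728227525828705, 761231827049515105, 761231828143054945,
   761231827049515105, 37, 13, 505819606854797665, 36152303149457505, 756728227422412945, 23,
   12, 25, 28, 35, 756710566203099505, 13, 36, 756728227373814625, 26, 756728227422144865,
   756728228781097825, 756728227374958945, 761231827049515105, 756728227422144865,
   756728227422412945, 756728227525828705, 12, 23, 35, 752189375777218705, 13,
   752189375776950625, 747685776149913745, 13, 752189734493626465, 507323738493362305, 13,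
   752189375777218705, 649936993417037665, 23, 12, 13, 747686134866255985, 747686134866276865,
   13, 747686134866276865, 40678648923496545, 31613794114347105, 25, 35, 56, 12, 13, 17, 18, 24,
   37, 435248552001085585, 23, 756710566205196625, 756710566785392785, 23, 435248550615583105,
   435248910630854785, 24, 34, 761214250969931905, 23, 435248550615583105, 761214457128362065,
   23, 435248550615583105, 435248910630854785, 24, 34, 756710566785392785, 23,
   756710566205196625, 435248552001085585, 23, 435248550615583105, 435248910630854785, 23,
   435248910630854785, 435248552001085585, 23, 435248552001085585, 435248910630854785, 17, 24,
   13, 67, 579399061082480785, 579399061082480785, 23, 752207326593163345, 36134626406244465,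
   26, 13, 23, 435248550616631665, 435248910630920305, 23, 435248910630920305,
   40638226570420305, 34, 752206966579077265, 650216338643681905, 78, 650776787251496785, 28,
   651456654537263185, 34, 651474246990694225, 36, 651474246990694225, 761249487907746385, 13,
   12, 23, 435248910630854785, 435248910717448705, 23, 435248910717448705, 40638516749082705,
   578159773459024465, 12, 13, 23, 435248552001085585, 435248910717448705, 23,
   435248910717448705, 40638226838790225, 650211629420644945, 24, 34, 47, 48, 17, 57, 28, 12,
   13, 579381399593814385, 35, 578160942105239665, 579381399861105265, 579381401250701425, 26,
   13, 579381400713830545, 579381399594279025, 13, 752189374392830305, 578160941684771185, 15,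
   56, 26, 13, 579381400713830545, 579381399594279025, 25, 13, 579398992631439505,
   579398991780323425, 579398991780126865, 13, 579398992631439505, 579398991785100385,
   650211616535743105, 78, 650775687739869025, 28, 651438993631742065, 35, 651474178271217505,
   36, 651474178271217505, 761249419188269665, 12, 13, 15, 17, 18, 25, 37, 761196864942317665,
   761249418920986465, 23, 747685774764411265, 651439010052442225, 28, 747686134779682945,
   650778189068771425, 25, 35, 756710566785059185, 23, 756692974019152225, 761249419188373345,
   23, 747685774764411265, 651474194424530785, 25, 35, 761196727503364225, 578157643157341345,
   578157645077422225, 23, 747686134779682945, 761196575032025185, 23, 747685776149913745,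
   651439010052841585, 12, 13, 15, 17, 18, 25, 35, 756710566785059185, 23, 756692974019152225,
   579381331457345905, 23, 747685774764411265, 649936992031869025, 25, 35, 756710566785059185,
   23, 756692974019152225, 761249350784517985, 23, 747685774764411265, 651474178003830625, 37,
   747685776149913745, 650778189085483105, 25, 35, 756692974867783825, 650215239132061825,
   650215237462655905, 23, 747686134779682945, 579381331457810545, 23, 747685776149913745,
   649936992031869025, 13, 12, 23, 747686134779682945, 747686134866276865, 23,
   747686134866276865, 40620924563038305, 577878298482313825, 12, 13, 23, 747685776149913745,
   747686134866276865, 23, 747686134866276865, 40620634652745825, 649930154443934305, 36, 23,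
   13, 68, 34, 48, 25, 24, 35, 58, 650215169054089345, 28, 651438993635025025,
   651438995020193905, 56, 507024670525628545, 752207330887868545, 26, 12, 14,
   680226084205233025, 15, 761231827007636065, 650494212768400225, 650494444430297185,
   650500080020955265, 28, 12, 651439010052776065, 651438993635025025, 15, 761231758013269585,
   506102248410120865, 14, 28, 24, 37, 680226079893692545, 756692975673090145, 25, 18,
   651439147578315265, 650497811993469025, 761231827001161825, 12, 651439147578302545,
   650499943370661985, 35, 12, 761231827002329185, 761231827002728545, 15, 28,
   680226084188594305, 579117517077938785, 36158560933184145, 14, 24, 28, 680226079893692545,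
   26, 761231758016514145, 58, 507042694909075585, 650500080826188625, 26, 761231828123394145,
   761231828140032865, 17, 761231827049914465, 761249420057707105, 28, 34, 18, 48, 14,
   651438993946314865, 12, 651439010052442225, 651456602325393505, 24, 35, 14,
   651456670958166145, 505814974959525985, 14, 651439216247447665, 507323805823737985,
   507323805822129025, 15, 12, 651456602238754945, 651456586132627585, 651438993946714225, 14,
   18, 47, 747743790524014705, 651456585817786465, 12, 651456670958166145, 651456654852038785,
   12, 507323806961049745, 36157457213431905, 34, 12, 651439010139349105, 651438995020193905,
   12, 651421486672781425, 684653405213491825, 14, 12, 15, 24, 761196573646522465, 25,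
   761214165832566865, 46, 761196574763524225, 761231758017562705, 25, 47, 761196575032025185,
   761249350204655185, 761214167218069585, 24, 761196575032025185, 761214165833615185, 24, 46,
   761196573646522465, 577872538276858465, 761196575032025185, 24, 12, 15, 28, 14,
   761196575031691105, 26, 46, 761196575032025185, 761231759403779665, 761214167217735505,
   761214167217735505, 14, 761196575031691105, 46, 761196575032025185, 577872568998037345, 14,
   761196575032025185, 761214167217735505, 14, 47, 761196575031691105, 505814972048214625,
   761196575032025185, 14, 15, 24, 25, 761214165830469745, 12, 761196573641181025,
   761196573646522465, 26, 46, 761231827049515105, 761196575032025185, 761214165827225425, 25,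
   56, 12, 761214165832566865, 761214167218069585, 17, 26, 761214165833615185,
   578441386471432705, 761249487907746385, 12, 761214167218069585, 36134627479855185, 24, 48,
   12, 15, 17, 57, 761214167217735505, 761249350199309905, 752189374393878625,
   752189374393878625, 752189375777415265, 12, 761196573646522465, 761196575032025185, 12,
   761196575032025185, 36117035293810785, 28, 24, 57, 23, 47, 12, 26, 37, 15, 46, 36,
   505819604935903585, 505821803957330065, 14, 579398992094699665, 17, 13, 18,
   579381399867491185, 25, 761249419191583345, 35, 761249487906698065, 650216338643689585,
   579381399908851825, 747685774766508145, 13, 14, 747686066059872625, 46, 579381399908720785,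
   579381399867491185, 579381399908387185, 13, 35, 36, 67, 578437950481244305,
   507306144648173665, 17, 579398992648151185, 684729683832668785, 17, 747685774765459825,
   684729683832668785, 14, 756692974019152225, 578155377335017585, 14, 13, 37,
   747686066059872625, 17, 577879398842239345, 579381401250906625, 15, 434686029396576625,
   579398992651100305, 18, 46, 15, 434686029396910225, 577879398842572945, 17,
   579398992651129345, 752207262168391825, 761249488223608945, 14, 15, 434686029396910225,
   577879398842703985, 578160873550979185, 37, 17, 14, 34, 12, 747686066059872625,
   747686066060206225, 56, 26, 507323805556285585, 578160942001889425, 12, 13, 25, 36,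
   507323805870459265, 579399060766722385, 579399060765578065, 507323807229485185,
   507323805556285585, 12, 747686066060206225, 578160942001555825, 15, 46, 12,
   578519742599422465, 756728227107572065, 12, 579399008304259585, 40673495032553985, 34,
   684729679520859985, 650893636178938465, 35, 12, 13, 579363892651630705, 684729679521194065,
   13, 578160943343870065, 40680847946686545, 12, 684729679520859985, 684670564356458065, 37,
   38, 15, 13, 435248842014728305, 756710567859134545, 17, 13, 579364098759729265,
   578160941960732785, 47, 747686066163556465, 650893995882448465, 14, 761196574494820465, 15,
   761214166412429425, 761249487907850065, 17, 435248552269586545, 684653405213499505, 37, 25,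
   15, 35, 78, 12, 17, 579363892651630705, 579363892651651585, 13, 435248550615583105,
   579363892651630705, 12, 761249504097738865, 761214457128362065, 38, 12, 13,
   756710926220134225, 756710926220468305, 13, 756710926220468305, 40638448065847425, 78,
   650216490561839185, 761249419188641905, 78, 12, 13, 435248842014749185, 650777020837863505,
   40638516749082705, 12, 761249504097759745, 31631317494472785, 17, 435248842014728305,
   578441386454721025, 38, 13, 12, 579381690928996465, 579381690929017345, 579381401250722305,
   579381401250701425, 34, 78, 14, 47, 18, 684729683835625585, 13, 15, 36, 747685776253263985,
   17, 579398993456406625, 57, 579399062156296705, 761249419192566625, 579381401270362225,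
   579381401270362225, 17, 684729683835625585, 578441318003679745, 17, 579381401270383105,
   651474179123847265, 47, 57, 17, 14, 761249419792228465, 761249419792249345, 13,
   761249351053287505, 761256796915631185, 14, 761249419235559265, 761249419235893345,
   761249435395039345, 37, 13, 747686066163556465, 756768581861449825, 756768581861115745, 37,
   14, 38, 47, 18, 747686066060337265, 13, 761196864941983585, 761249419235559265, 34, 17,
   761196864941983585, 761249435395060225, 13, 756693334034089825, 756693334034423905, 78, 13,
   48, 747686152985649265, 651439216281002065, 761196573646522465, 651474178875072625, 34, 46,
   13, 761196573646522465, 761196864942317665, 17, 13, 15, 18, 579398992053535585, 38,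
   579398992047245665, 650781623656395265, 579398992053535585, 579398992094896225,
   752189374393878625, 13, 761196864942317665, 31613794027839585, 38, 34, 17, 47, 13,
   747685774765459825, 761196573647904865, 13, 579364098759729265, 761249488777191505,
   579381401267679745, 46, 17, 761236997116397665, 761249488777327105, 761231758013269585, 47,
   17, 761196573647570785, 761214461439836785, 761249488777191505, 17, 28, 14, 56, 13, 46, 12,
   18, 36, 15, 24, 23, 747685997340395905, 25, 434404554419865985, 507323805555886465, 27, 47,
   23, 747685997427302545, 506103347649055105, 23, 756728227378103185, 756728295827048785,
   756728295827048785, 25, 35, 24, 38, 506102180001489025, 761231896037564545, 23, 27, 47,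
   747685997427302545, 752189376045385825, 756728296094339665, 506103347649055105, 23,
   435248773191966865, 650875976884029265, 23, 435248552269586545, 507323805555886465, 23, 35,
   38, 68, 650495545861021825, 651421332724025185, 26, 761231827603234945, 608168490167305105,
   26, 747685775881144705, 608168490167305105, 24, 752189376045385825, 506097783028719745, 24,
   23, 36, 747685997340395905, 26, 505821803954964865, 507323807213044225, 25,
   434404554419865985, 761231826737176705, 27, 47, 23, 34, 25, 761214392723316865,
   761231828123533825, 25, 434404554523549825, 761231828123533825, 761231895455604865, 25,
   434404554523549825, 756728228764598785, 756728295828234385, 24, 25, 434404554523549825,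
   505821803958378625, 506103278935023745, 36, 26, 24, 34, 12, 747685997340395905,
   747685997444079745, 58, 18, 651438994751758465, 506103349305942145, 12, 15, 37,
   761232049350664705, 756728296094435665, 651456585815589985, 651438994751758465, 12,
   747685997444079745, 506103347649055105, 25, 48, 12, 507025098464592385, 651456585817786465,
   12, 761231843209019905, 36152303252693505, 34, 507323738493558865, 579117516803148385, 35,
   12, 23, 507306298510418065, 608168485959245905, 23, 506103347964027025, 40656108935061585,
   12, 608168485855562065, 650893569070073425, 36, 37, 25, 23, 435248773191966865,
   752206968231829585, 26, 23, 507306435949240465, 506103347922804865, 46, 747685997340795025,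
   579117876821231185, 24, 756692974018103665, 25, 756710566203099505, 756728296094435665, 26,
   435248551732781185, 680149805586129025, 36, 15, 25, 35, 67, 12, 26, 507306298510418065,
   507306298613727745, 23, 435248552269187185, 507306298510418065, 12, 756728312247951505,
   756710788884865105, 37, 12, 23, 752207257873287505, 752207257976971345, 23,
   752207257976971345, 40638516748951665, 67, 578159996155469905, 756728227375227025, 67, 12,
   23, 435248773295276545, 578437951554986065, 36134848505585745, 12, 756728312351445505,
   40638448116179025, 26, 435248773191966865, 650497882323165265, 37, 23, 12,
   507324028135219345, 507324028238713345, 507323805974168065, 507323805870858385, 34, 67, 24,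
   46, 27, 608168490150666385, 23, 25, 38, 747685774764810385, 26, 761231826739273825, 56,
   761231896037835265, 756728227381314145, 507323805560217745, 507323805560217745, 26,
   608168490150666385, 650497813603688545, 26, 507323807213044225, 579398993436745825, 46, 56,
   26, 24, 756728227109806225, 756728228764598785, 23, 756728160045113425, 756770789474305105,
   24, 756728227107572065, 650494212495771745, 650494444426103425, 36, 23, 747685997340795025,
   650858384697984865, 650858382770612065, 26, 12, 14, 23, 25, 18, 37, 13, 15, 46, 35,
   761214165827225425, 34, 761196574763255905, 761231758016514145, 34, 67, 761256788325697105,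
   756728295832290385, 761196864941983585, 57, 34, 761255688814069585, 36, 761255688814069585,
   435248550616631665, 435248550617679985, 34, 24, 761196864941983585, 57, 761214457128027985,
   761249435341686625, 761214165833615185, 38, 34, 13, 27, 48, 651474178270065505, 24,
   756692974013814625, 579381400713692305, 756692974013814625, 756710566207293265, 46,
   761231758016514145, 651456586132359265, 58, 756710566207293265, 651474179140485985, 38, 58,
   435248910630520945, 35, 651421333846499425, 684670703731155025, 650218536845197825, 35, 58,
   67, 15, 56, 761231895769391185, 761256796935430225, 761231895769391185, 15, 34,
   761196727503030385, 47, 761249418918786145, 752207330907529345, 761249488760479825, 37,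
   761214457198157905, 761249487955035985, 37, 761214457198157905, 756728297500647505, 36, 13,
   38, 35, 15, 761214388408551505, 56, 506103347916441985, 650218535997539185,
   761196574763255905, 761196574763255905, 761214457128027985, 761196574494820465, 34, 57, 27,
   24, 35, 752207051801763985, 23, 36, 46, 761231827002229345, 579381399599055985,
   579381330872145745, 578160872965314385, 578160941686983025, 35, 761214165827225425, 36, 46,
   761231827002229345, 761249488223470705, 579399060813908305, 24, 35, 25, 761214250969598065,
   761214166949300305, 36, 761231895454419025, 651456654851835985, 761249420041003105, 37, 23,
   747686066060337265, 36192641551966305, 756728228781163105, 37, 34, 761196573645473905, 35,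
   761214165830469745, 46, 761231826734942305, 36117393655079025, 34, 35, 761214165833615185,
   761196573647570785, 761214165833615185, 36, 14, 46, 15, 56, 761231895769194625,
   761231827049914465, 761196796222507105, 34, 761231843209019905, 578441318003679745, 47, 34,
   761196573647570785, 761196796222906465, 756692974021248865, 14, 761231827606209025,
   761231896037835265, 28, 36, 24, 37, 46, 27, 747685997427302545, 23, 756693196595136865,
   756728227107572065, 34, 26, 756693196595136865, 756728243631972865, 23, 752189665687243105,
   649934794930653025, 67, 23, 47, 747686079971205265, 579381553453932625, 756692975672756065,
   579398991782092945, 34, 47, 27, 23, 747685776149580145, 747685997427302545, 57,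
   752207262188052625, 578442485656912465, 23, 756692975672756065, 756728228764459105, 23,
   756693196698820705, 40620924632834145, 37, 34, 26, 46, 23, 747685775881144705,
   756692975742885985, 23, 507306435949240465, 756728297500647505, 507323806961447425, 48, 26,
   651421332724025185, 756728297500783105, 651474109282154065, 46, 26, 756692975135885665,
   756710793092924305, 756728297500647505, 26, 23, 48, 25, 35, 34, 761214165827225425, 36,
   761214165827225425, 761214165827225425, 38, 27, 36, 56, 761231895454419025,
   651474247037880145, 651474178270065505, 651474178318403425, 68, 651474179140485985,
   651456587222877025, 38, 651474178318403425, 68, 651474179123847265, 651456587206238305, 58,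
   38, 24, 27, 34, 756692974013814625, 35, 651474246989542225, 761249420057707105,
   651474247037880145, 651474247037880145, 35, 651474247862984785, 650500080826261585, 34,
   651474110404232785, 650497813620400225, 36, 34, 761196796222507105, 761214167217735505,
   761214167217735505, 36, 46, 761196796222507105, 761231896842870865, 761231896842945025]

lemma check_certSixZero : check 6 0 certSixZero = true := by decide +kernel

lemma check_certSevenZero : check 7 0 certSevenZero = true := by decide +kernel

lemma check_certSevenOne : check 7 1 certSevenOne = true := by decide +kernel

lemma check_certEightZero : check 8 0 certEightZero = true := by decide +kernel

lemma check_certEightOne : check 8 1 certEightOne = true := by decide +kernel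

lemma check_certEightTwo : check 8 2 certEightTwo = true := by decide +kernel

lemma check_certNineZero : check 9 0 certNineZero = true := by decide +kernel

lemma check_certNineOne : check 9 1 certNineOne = true := by decide +kernel

lemma check_certNineTwo : check 9 2 certNineTwo = true := by decide +kernel

lemma check_certNineThree : check 9 3 certNineThree = true := by decide +kernel

/-- All entries of the bit matrix `P` satisfy `r`. -/
def Sound (r : ℕ → ℕ → Prop) (P : ℕ) : Prop :=
  ∀ u v, v < 16 → has P u v = true → r u v

lemma has_put {P u v a b : ℕ} (hu : u < 16) (hv : v < 16) (hb : b < 16)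
    (h : has (put P u v) a b = true) : has P a b = true ∨ (a = u ∧ b = v) ∨ (a = v ∧ b = u) := by
  simp only [has, put, Nat.testBit_or, Nat.one_shiftLeft, Nat.testBit_two_pow, Bool.or_eq_true,
    decide_eq_true_eq] at h ⊢
  rcases h with (h | h) | h
  · exact Or.inl h
  · exact Or.inr (by omega)
  · exact Or.inr (by omega)

lemma Sound.put {r : ℕ → ℕ → Prop} {P u v : ℕ} (h : Sound r P) (hu : u < 16) (hv : v < 16)
    (huv : r u v) (hvu : r v u) : Sound r (put P u v) := by
  intro a b hb hab
  rcases has_put hu hv hb hab with h1 | ⟨rfl, rfl⟩ | ⟨rfl, rfl⟩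
  · exact h a b hb h1
  · exact huv
  · exact hvu

lemma sound_zero (r : ℕ → ℕ → Prop) : Sound r 0 := by
  intro u v _ h
  simp [has] at h

lemma count_eq (A a k : ℕ) : count A a k = ((Finset.range k).filter fun u => has A a u).card := by
  induction k with
  | zero => rfl
  | succ k ih =>
    rw [Finset.range_add_one, Finset.filter_insert, count, ih]
    cases h : has A a k <;> simp

lemma Sound.fill {r : ℕ → ℕ → Prop} (hr : ∀ a b, r a b → r b a) {A a P : ℕ} (h : Sound r P)
    (ha : a < 16) (k : ℕ) (hk : k ≤ 16)
    (hA : ∀ u < k, u ≠ a → ¬ has A a u = true → r a u) : Sound r (fill A a P k) := by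
  induction k generalizing P with
  | zero => exact h
  | succ k ih =>
    have hA' : ∀ u < k, u ≠ a → ¬ has A a u = true → r a u := fun u hu => hA u (by omega)
    rw [CliqueCert.fill]
    cases hc : (Nat.beq a k || has A a k) with
    | true => exact ih h (by omega) hA'
    | false =>
      simp only [Bool.or_eq_false_iff] at hc
      have hne : k ≠ a := fun e => by simp [e] at hc
      have := hA k (by omega) hne (by simp [hc.2])
      exact ih (h.put ha (by omega) this (hr _ _ this)) (by omega) hA'

section Soundness

variable {n D : ℕ} {r : ℕ → ℕ → Prop}

/-- Non-adjacency of distinct vertices below `n`. -/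
def NonAdj (n : ℕ) (r : ℕ → ℕ → Prop) (u v : ℕ) : Prop := u < n ∧ v < n ∧ u ≠ v ∧ ¬ r u v

/-- The hypotheses on the adjacency relation under which certificates are sound. -/
structure Admissible (n D : ℕ) (r : ℕ → ℕ → Prop) : Prop where
  le : n < 16
  symm : ∀ a b, r a b → r b a
  apex : ∀ a b, NonAdj n r a b → r a n
  bound : ∀ a, ∀ s : Finset ℕ, (∀ u ∈ s, NonAdj n r a u) → s.card ≤ D

lemma NonAdj.symm (hr : Admissible n D r) {a b : ℕ} (h : NonAdj n r a b) : NonAdj n r b a :=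
  ⟨h.2.1, h.1, h.2.2.1.symm, fun hb => h.2.2.2 (hr.symm _ _ hb)⟩

lemma Sound.saturate (hr : Admissible n D r) {A a P : ℕ} (h : Sound r P)
    (hA : Sound (NonAdj n r) A) (ha : a < n) : Sound r (saturate n D A a P) := by
  have hn := hr.le
  rw [CliqueCert.saturate]
  cases hc : Nat.beq (count A a n) D with
  | false => exact h
  | true =>
    refine h.fill hr.symm (by omega) n hn.le fun u hu hua hau => ?_
    by_contra hcon
    have hD := Nat.eq_of_beq_eq_true hc
    rw [count_eq] at hD
    have hmem : u ∉ (Finset.range n).filter fun u => has A a u := by simp [hau]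
    have := hr.bound a (insert u ((Finset.range n).filter fun u => has A a u)) (by
      intro w hw
      rcases Finset.mem_insert.1 hw with rfl | hw
      · exact ⟨ha, hu, hua.symm, hcon⟩
      · rw [Finset.mem_filter, Finset.mem_range] at hw
        exact hA a w (by omega) hw.2)
    rw [Finset.card_insert_of_notMem hmem] at this
    omega

lemma Sound.saturateAll (hr : Admissible n D r) {A P : ℕ} (h : Sound r P)
    (hA : Sound (NonAdj n r) A) (k : ℕ) (hk : k ≤ n) : Sound r (saturateAll n D A P k) := by
  induction k with
  | zero => exact h
  | succ k ih => exact (ih (by omega)).saturate hr hA (by omega)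

lemma Sound.exclude (hr : Admissible n D r) {A a b P : ℕ} (h : Sound r P)
    (hA : Sound (NonAdj n r) A) (hab : NonAdj n r a b) : Sound r (exclude n D A a b P) := by
  have hn := hr.le
  have ha := hr.apex _ _ hab
  have hb := hr.apex _ _ (hab.symm hr)
  have h1 := hab.1
  have h2 := hab.2.1
  exact (((h.put (by omega) hn ha (hr.symm _ _ ha)).put (by omega) hn hb
    (hr.symm _ _ hb)).saturate hr hA h2).saturate hr hA h1

lemma exists_model_of_run (hr : Admissible n D r) (k P A : ℕ) (ts ts' : List ℕ) (h : Sound r P)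
    (hA : Sound (NonAdj n r) A) (hrun : run n D k P A ts = some ts') :
    ∃ P ls, Sound r P ∧ isModel n P ls = true := by
  induction k generalizing P A ts ts' with
  | zero => simp [run] at hrun
  | succ k ih =>
    cases ts with
    | nil => simp [run] at hrun
    | cons t ts =>
      rw [run] at hrun
      split at hrun
      · split at hrun
        · simp at hrun
        · rename_i ts₁ h₁
          split at hrun
          · rename_i hc
            have hn := hr.le
            simp only [Bool.and_eq_true, Nat.blt_eq, Bool.not_eq_true'] at hc
            obtain ⟨⟨ha, hb⟩, hab⟩ := hc
            have hab' := Nat.ne_of_beq_eq_false hab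
            by_cases hadj : r (t / 10) (t % 10)
            · exact ih _ _ _ _ (h.put (by omega) (by omega) hadj (hr.symm _ _ hadj)) hA h₁
            · have hnon : NonAdj n r (t / 10) (t % 10) := ⟨ha, hb, hab', hadj⟩
              have hA' := hA.put (by omega) (by omega) hnon (hnon.symm hr)
              exact ih _ _ _ _ (h.exclude hr hA' hnon) hA' hrun
          · simp at hrun
      · cases hc : isModel n P (decode 16 t []) with
        | true => exact ⟨P, _, h, hc⟩
        | false => simp [hc] at hrun

lemma sound_start (hr : Admissible n D r) (k : ℕ)
    (h : ∀ u, 1 ≤ u → u ≤ k → NonAdj n r 0 u) : Sound (NonAdj n r) (start k) := by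
  induction k with
  | zero => exact sound_zero _
  | succ k ih =>
    have h1 := h (k + 1) (by omega) le_rfl
    have hn := hr.le
    have := h1.2.1
    exact (ih fun u hu hk => h u hu (by omega)).put (by omega) (by omega) h1 (h1.symm hr)

lemma sound_startAdj (hr : Admissible n D r) (k : ℕ)
    (h : ∀ u, 1 ≤ u → u ≤ k → NonAdj n r 0 u) : Sound r (startAdj n k) := by
  induction k with
  | zero => exact sound_zero _
  | succ k ih =>
    have h1 := h (k + 1) (by omega) le_rfl
    have hn := hr.le
    have h2 := h1.2.1
    have h3 := hr.apex _ _ h1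
    have h4 := hr.apex _ _ (h1.symm hr)
    exact ((ih fun u hu hk => h u hu (by omega)).put (by omega) (by omega) h3
      (hr.symm _ _ h3)).put (by omega) (by omega) h4 (hr.symm _ _ h4)

lemma exists_model_of_check (hr : Admissible n D r) {ts : List ℕ}
    (h : ∀ u, 1 ≤ u → u ≤ D → NonAdj n r 0 u) (hts : check n D ts = true) :
    ∃ P ls, Sound r P ∧ isModel n P ls = true := by
  rw [check, Option.isSome_iff_exists] at hts
  obtain ⟨ts', hts'⟩ := hts
  have hA := sound_start hr D h
  exact exists_model_of_run hr _ _ _ _ _ ((sound_startAdj hr D h).saturateAll hr hA n le_rfl) hA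
    hts'

end Soundness

/-- In the cases of interest, a model of `K₆` exists. -/
lemma exists_model {n D : ℕ} {r : ℕ → ℕ → Prop} (hn : 6 ≤ n) (hn' : n ≤ 9) (hD : D ≤ n - 6)
    (hr : Admissible n D r) (h : ∀ u, 1 ≤ u → u ≤ D → NonAdj n r 0 u) :
    ∃ P ls, Sound r P ∧ isModel n P ls = true := by
  interval_cases n <;> interval_cases D
  · exact exists_model_of_check hr h check_certSixZero
  · exact exists_model_of_check hr h check_certSevenZero
  · exact exists_model_of_check hr h check_certSevenOne
  · exact exists_model_of_check hr h check_certEightZero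
  · exact exists_model_of_check hr h check_certEightOne
  · exact exists_model_of_check hr h check_certEightTwo
  · exact exists_model_of_check hr h check_certNineZero
  · exact exists_model_of_check hr h check_certNineOne
  · exact exists_model_of_check hr h check_certNineTwo
  · exact exists_model_of_check hr h check_certNineThree

end CliqueCert

open CliqueCert in
/-- Branch sets `B i` and a model of `K₆` in the quotient graph, together with a further vertex `x`
adjacent to almost all branch sets, yield a `K₇` minor. -/
lemma hasCompleteMinor_of_isModel {V : Type} {G : SimpleGraph V} {n P : ℕ} {ls : List (List ℕ)}
    {B : ℕ → Set V} {x : V} (hn : n < 16) (hconn : ∀ i ≤ n, (G.induce (B i)).Connected)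
    (hdisj : ∀ i ≤ n, ∀ j ≤ n, i ≠ j → Disjoint (B i) (B j)) (hxB : ∀ i ≤ n, x ∉ B i)
    (hx : ∀ i < n, ∃ u ∈ B i, G.Adj x u)
    (hP : Sound (fun i j => ∃ u ∈ B i, ∃ v ∈ B j, G.Adj u v) P) (hls : isModel n P ls = true) :
    HasCompleteMinor G 7 := by
  have hlinked : ∀ l : List ℕ, linked n P l = true →
      (∀ i ∈ l, i ≤ n) ∧ (G.induce {v | ∃ i ∈ l, v ∈ B i}).Connected := by
    intro l
    induction l with
    | nil => intro h; simp [linked] at h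
    | cons a l ih =>
      intro h
      cases l with
      | nil =>
        have ha : a ≤ n := Nat.le_of_ble_eq_true (by simpa only [linked] using h)
        refine ⟨by simpa using ha, ?_⟩
        have : {v | ∃ i ∈ [a], v ∈ B i} = B a := by ext; simp
        rw [this]
        exact hconn a ha
      | cons b l =>
        rw [linked, Bool.and_eq_true, Bool.and_eq_true, List.any_eq_true] at h
        obtain ⟨⟨ha, c, hc, hac⟩, hrest⟩ := h
        have ha := Nat.le_of_ble_eq_true ha
        obtain ⟨hle, hcon⟩ := ih hrest
        refine ⟨by simpa [ha] using hle, ?_⟩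
        obtain ⟨u, hu, v, hv, huv⟩ := hP a c (by have := hle c hc; omega) hac
        have : {v | ∃ i ∈ a :: b :: l, v ∈ B i} = B a ∪ {v | ∃ i ∈ b :: l, v ∈ B i} := by
          ext; simp
        rw [this]
        exact connected_induce_union (hconn a ha).preconnected hcon.preconnected hu ⟨c, hc, hv⟩ huv
  have hpair : ∀ ls : List (List ℕ), allTouch P ls = true →
      ls.Pairwise fun l l' => touch P l l' = true := by
    intro ls
    induction ls with
    | nil => intro _; exact List.Pairwise.nil
    | cons l ls ih =>
      intro h
      rw [allTouch, Bool.and_eq_true, List.all_eq_true] at h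
      exact List.Pairwise.cons h.1 (ih h.2)
  rw [isModel, Bool.and_eq_true, Bool.and_eq_true, List.all_eq_true] at hls
  obtain ⟨⟨hlen, hall⟩, htouch⟩ := hls
  have hlen := Nat.eq_of_beq_eq_true hlen
  have hpw := List.pairwise_iff_getElem.1 (hpair ls htouch)
  simp only [Bool.and_eq_true, List.any_eq_true, Nat.blt_eq] at hall
  let U : Fin 6 → Set V := fun i => {v | ∃ j ∈ ls[i.1], v ∈ B j}
  have hmem : ∀ i : Fin 6, ls[i.1] ∈ ls := fun i => List.getElem_mem _
  have hU : ∀ i j, i < j → Disjoint (U i) (U j) ∧ ∃ u ∈ U i, ∃ v ∈ U j, G.Adj u v := by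
    intro i j hij
    have h := hpw i.1 j.1 (by omega) (by omega) hij
    rw [touch, Bool.and_eq_true] at h
    simp only [List.any_eq_true, List.all_eq_true, Bool.not_eq_true'] at h
    have hi := (hlinked _ (hall _ (hmem i)).1).1
    have hj := (hlinked _ (hall _ (hmem j)).1).1
    constructor
    · rw [Set.disjoint_left]
      rintro v ⟨a, ha, hva⟩ ⟨b, hb, hvb⟩
      exact Set.disjoint_left.1 (hdisj a (hi a ha) b (hj b hb)
        (Nat.ne_of_beq_eq_false (h.2 a ha b hb))) hva hvb
    · obtain ⟨a, ha, b, hb, hab⟩ := h.1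
      obtain ⟨u, hu, v, hv, huv⟩ := hP a b (by have := hj b hb; omega) hab
      exact ⟨u, ⟨a, ha, hu⟩, v, ⟨b, hb, hv⟩, huv⟩
  have hUconn : ∀ i, (G.induce (U i)).Connected := fun i => (hlinked _ (hall _ (hmem i)).1).2
  have hxU : ∀ i, x ∉ U i := by
    rintro i ⟨a, ha, hxa⟩
    exact hxB a ((hlinked _ (hall _ (hmem i)).1).1 a ha) hxa
  have hxadj : ∀ i, ∃ u ∈ U i, G.Adj x u := by
    intro i
    obtain ⟨a, ha, han⟩ := (hall _ (hmem i)).2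
    obtain ⟨u, hu, hxu⟩ := hx a han
    exact ⟨u, ⟨a, ha, hu⟩, hxu⟩
  refine ⟨Fin.cons {x} U, ?_, ?_, ?_, ?_⟩
  · intro i
    cases i using Fin.cases with
    | zero => simp
    | succ i => obtain ⟨v⟩ := (hUconn i).nonempty; exact ⟨v.1, v.2⟩
  · intro i
    cases i using Fin.cases with
    | zero =>
      have : Nonempty ({x} : Set V) := ⟨x, rfl⟩
      exact (Connected.of_subsingleton : (G.induce {x}).Connected)
    | succ i => exact hUconn i
  · intro i j hij
    cases i using Fin.cases with
    | zero =>
      cases j using Fin.cases with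
      | zero => exact absurd rfl hij
      | succ j => simpa using hxU j
    | succ i =>
      cases j using Fin.cases with
      | zero => simpa using hxU i
      | succ j =>
        have hne : i ≠ j := fun h => hij (by rw [h])
        rcases lt_or_gt_of_ne hne with h | h
        · exact (hU i j h).1
        · exact (hU j i h).1.symm
  · intro i j hij
    cases i using Fin.cases with
    | zero =>
      cases j using Fin.cases with
      | zero => exact absurd rfl hij
      | succ j => simpa using hxadj j
    | succ i =>
      cases j using Fin.cases with
      | zero =>
        obtain ⟨u, hu, hxu⟩ := hxadj i
        exact ⟨u, hu, x, rfl, hxu.symm⟩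
      | succ j =>
        have hne : i ≠ j := fun h => hij (by rw [h])
        rcases lt_or_gt_of_ne hne with h | h
        · exact (hU i j h).2
        · obtain ⟨u, hu, v, hv, huv⟩ := (hU j i h).2
          exact ⟨v, hv, u, hu, huv.symm⟩

lemma exists_enumeration {α : Type} [DecidableEq α] {N S : Finset α} {v : α} (hv : v ∈ N)
    (hS : S ⊆ N) (hvS : v ∉ S) :
    ∃ g : ℕ → α, (∀ i < N.card, g i ∈ N) ∧ (∀ i < N.card, ∀ j < N.card, g i = g j → i = j) ∧
      g 0 = v ∧ ∀ i, 1 ≤ i → i ≤ S.card → g i ∈ S := by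
  let L : List α := v :: (S.toList ++ (N \ insert v S).toList)
  have hL : ∀ w, w ∈ L ↔ w ∈ N := by
    intro w
    simp only [L, List.mem_cons, List.mem_append, Finset.mem_toList, Finset.mem_sdiff,
      Finset.mem_insert]
    constructor
    · rintro (rfl | h | h)
      exacts [hv, hS h, h.1]
    · tauto
  have hnd : L.Nodup := by
    simp only [L, List.nodup_cons, List.nodup_append, List.mem_append, Finset.mem_toList,
      Finset.mem_sdiff, Finset.mem_insert, Finset.nodup_toList, true_and]
    refine ⟨by tauto, ?_⟩
    rintro a ha b hb rfl
    tauto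
  have hlen : L.length = N.card := by
    rw [← List.toFinset_card_of_nodup hnd]
    congr 1
    ext w
    rw [List.mem_toFinset, hL]
  refine ⟨fun i => L.getD i v, fun i hi => ?_, fun i hi j hj h => ?_, rfl, fun i h1 h2 => ?_⟩
  · have hi' : i < L.length := by omega
    simp only [← hL, List.getD_eq_getElem _ _ hi']
    exact List.getElem_mem _
  · have hi' : i < L.length := by omega
    have hj' : j < L.length := by omega
    simp only [List.getD_eq_getElem _ _ hi', List.getD_eq_getElem _ _ hj'] at h
    exact (hnd.getElem_inj_iff).1 h
  · obtain ⟨k, rfl⟩ : ∃ k, i = k + 1 := ⟨i - 1, by omega⟩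
    have hk : k < S.toList.length := by rw [Finset.length_toList]; omega
    simp only [L, List.getD_cons_succ]
    rw [List.getD_append _ _ _ _ hk, List.getD_eq_getElem _ _ hk, ← Finset.mem_toList]
    exact List.getElem_mem _

open Classical in
/-- The neighbours of `a` in `U`. -/
noncomputable def nbrs {V : Type} (G : SimpleGraph V) (U : Finset V) (a : V) : Finset V :=
  U.filter (G.Adj a)

@[simp]
lemma mem_nbrs {V : Type} {G : SimpleGraph V} {U : Finset V} {a b : V} :
    b ∈ nbrs G U a ↔ b ∈ U ∧ G.Adj a b := by
  simp [nbrs]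

open Classical CliqueCert in
/-- A vertex `x` of degree at most `9` all of whose edges lie in five triangles yields a `K₇` minor,
provided some connected set `D` avoiding the closed neighbourhood of `x` is joined to all neighbours
of `x` that are not adjacent to all others. -/
lemma hasCompleteMinor_of_neighborhood {V : Type} [Fintype V] {G : SimpleGraph V} {x : V}
    {D : Set V} (hpos : 0 < (nbrs G Finset.univ x).card) (hdeg : (nbrs G Finset.univ x).card ≤ 9)
    (htri : ∀ v, G.Adj x v → 5 ≤ (nbrs G Finset.univ x ∩ nbrs G Finset.univ v).card)
    (hD : (G.induce D).Connected) (hxD : x ∉ D) (hDN : ∀ v ∈ D, ¬ G.Adj x v)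
    (hN : ∀ v w, G.Adj x v → G.Adj x w → v ≠ w → ¬ G.Adj v w → ∃ d ∈ D, G.Adj v d) :
    HasCompleteMinor G 7 := by
  let N := nbrs G Finset.univ x
  let S : V → Finset V := fun v => N.filter fun w => v ≠ w ∧ ¬ G.Adj v w
  have hcard : ∀ v ∈ N, (S v).card + 6 ≤ N.card := by
    intro v hv
    have h1 : 5 ≤ (N ∩ nbrs G Finset.univ v).card := htri v (by simpa [N] using hv)
    have hsub : insert v (S v ∪ (N ∩ nbrs G Finset.univ v)) ⊆ N := by
      intro w hw
      simp only [S, Finset.mem_insert, Finset.mem_union, Finset.mem_filter, Finset.mem_inter] at hw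
      rcases hw with rfl | hw | hw
      exacts [hv, hw.1, hw.1]
    have h2 := Finset.card_le_card hsub
    rw [Finset.card_insert_of_notMem (by simp [S]), Finset.card_union_of_disjoint] at h2
    · omega
    · rw [Finset.disjoint_left]
      intro w hw hw'
      simp only [S, Finset.mem_filter] at hw
      simp only [Finset.mem_inter, mem_nbrs, Finset.mem_univ, true_and] at hw'
      exact hw.2.2 hw'.2
  have hNcard : N.card = (nbrs G Finset.univ x).card := rfl
  have hne : N.Nonempty := by rw [← Finset.card_pos]; omega
  obtain ⟨v, hv, hmax⟩ := Finset.exists_max_image N (fun v => (S v).card) hne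
  obtain ⟨g, hgN, hginj, hg0, hgS⟩ :=
    exists_enumeration hv (Finset.filter_subset _ _ : S v ⊆ N) (by simp)
  have hgx : ∀ i < N.card, G.Adj x (g i) := fun i hi => by simpa [N] using hgN i hi
  let B : ℕ → Set V := fun i => if i < N.card then {g i} else D
  have hBlt : ∀ i < N.card, B i = {g i} := fun i hi => if_pos hi
  have hBn : B N.card = D := if_neg (lt_irrefl _)
  have hlt : ∀ i ≤ N.card, i < N.card ∨ i = N.card := fun i hi => by omega
  have hvc := hcard v hv
  let r : ℕ → ℕ → Prop := fun i j => ∃ u ∈ B i, ∃ v ∈ B j, G.Adj u v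
  have hr : ∀ i < N.card, ∀ j < N.card, (r i j ↔ G.Adj (g i) (g j)) := by
    intro i hi j hj
    simp [r, hBlt i hi, hBlt j hj]
  have hadm : Admissible N.card (S v).card r := by
    refine ⟨by omega, ?_, ?_, ?_⟩
    · rintro a b ⟨u, hu, w, hw, h⟩
      exact ⟨w, hw, u, hu, h.symm⟩
    · rintro a b ⟨ha, hb, hab, h⟩
      rw [hr a ha b hb] at h
      obtain ⟨d, hd, had⟩ := hN _ _ (hgx a ha) (hgx b hb) (fun e => hab (hginj a ha b hb e)) h
      exact ⟨g a, by simp [hBlt a ha], d, by rwa [hBn], had⟩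
    · intro a s hs
      rcases s.eq_empty_or_nonempty with rfl | ⟨u, hu⟩
      · simp
      have ha := (hs u hu).1
      refine le_trans ?_ (hmax (g a) (hgN a ha))
      refine Finset.card_le_card_of_injOn g ?_ ?_
      · intro w hw
        obtain ⟨-, hw, haw, h⟩ := hs w hw
        rw [hr a ha w hw] at h
        exact Finset.mem_coe.2 <| Finset.mem_filter.2 ⟨hgN w hw, fun e => haw (hginj a ha w hw e), h⟩
      · intro i hi j hj h
        exact hginj i (hs i hi).2.1 j (hs j hj).2.1 h
  obtain ⟨P, ls, hP, hls⟩ := exists_model (n := N.card) (D := (S v).card) (r := r) (by omega)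
    (by omega) (by omega) hadm (by
      intro i h1 h2
      have hi : i < N.card := by omega
      have h3 := hgS i h1 h2
      simp only [Finset.mem_filter] at h3
      refine ⟨by omega, hi, by omega, ?_⟩
      rw [hr 0 (by omega) i hi, hg0]
      exact h3.2.2)
  refine hasCompleteMinor_of_isModel (n := N.card) (B := B) (x := x) (by omega) ?_ ?_ ?_ ?_ hP hls
  · intro i hi
    rcases hlt i hi with h | rfl
    · rw [hBlt i h]
      exact Connected.of_subsingleton
    · rwa [hBn]
  · intro i hi j hj hij
    have hgD : ∀ i < N.card, g i ∉ D := fun i hi h => hDN _ h (hgx i hi)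
    rcases hlt i hi with h | rfl <;> rcases hlt j hj with h' | rfl
    · rw [hBlt i h, hBlt j h', Set.disjoint_singleton]
      exact fun e => hij (hginj i h j h' e)
    · rw [hBlt i h, hBn, Set.disjoint_singleton_left]
      exact hgD i h
    · rw [hBlt j h', hBn, Set.disjoint_singleton_right]
      exact hgD j h'
    · exact absurd rfl hij
  · intro i hi
    rcases hlt i hi with h | rfl
    · rw [hBlt i h, Set.mem_singleton_iff]
      exact (hgx i h).ne
    · rwa [hBn]
  · intro i hi
    exact ⟨g i, by simp [hBlt i hi], hgx i hi⟩

/-! ### Minors -/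

section Minors

variable {V W : Type}

/-- A model of `H` in `G` turns complete minors of `H` into complete minors of `G`. -/
lemma HasCompleteMinor.of_model {G : SimpleGraph V} {H : SimpleGraph W} {m : ℕ} (B : W → Set V)
    (hconn : ∀ w, (G.induce (B w)).Connected) (hdisj : ∀ w w', w ≠ w' → Disjoint (B w) (B w'))
    (hadj : ∀ w w', H.Adj w w' → ∃ u ∈ B w, ∃ v ∈ B w', G.Adj u v)
    (h : HasCompleteMinor H m) : HasCompleteMinor G m := by
  obtain ⟨f, hne, hc, hd, ha⟩ := h
  have hBne : ∀ w, ∃ v, v ∈ B w := fun w => by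
    obtain ⟨v⟩ := (hconn w).nonempty
    exact ⟨v.1, v.2⟩
  refine ⟨fun i => {v | ∃ w ∈ f i, v ∈ B w}, fun i => ?_, fun i => ?_, fun i j hij => ?_,
    fun i j hij => ?_⟩
  · obtain ⟨w, hw⟩ := hne i
    obtain ⟨v, hv⟩ := hBne w
    exact ⟨v, w, hw, hv⟩
  · set T : Set V := {v | ∃ w ∈ f i, v ∈ B w} with hT
    have hstep : ∀ w (hw : w ∈ f i) u (hu : u ∈ B w) v (hv : v ∈ B w),
        (G.induce T).Reachable ⟨u, w, hw, hu⟩ ⟨v, w, hw, hv⟩ := by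
      intro w hw u hu v hv
      have hsub : B w ≤ T := fun z hz => ⟨w, hw, hz⟩
      exact ((hconn w).preconnected ⟨u, hu⟩ ⟨v, hv⟩).map (induceHomOfLE G hsub).toHom
    have hwalk : ∀ w w' : f i, (H.induce (f i)).Walk w w' → ∀ u (hu : u ∈ B w) v (hv : v ∈ B w'),
        (G.induce T).Reachable ⟨u, w, w.2, hu⟩ ⟨v, w', w'.2, hv⟩ := by
      intro w w' p
      induction p with
      | nil => exact fun u hu v hv => hstep _ (Subtype.prop _) u hu v hv
      | @cons a b c hab p ih =>
        intro u hu v hv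
        obtain ⟨u₁, hu₁, v₁, hv₁, h₁⟩ := hadj a b hab
        have hreach : (G.induce T).Reachable ⟨u₁, a, a.2, hu₁⟩ ⟨v₁, b, b.2, hv₁⟩ :=
          Adj.reachable (G := G.induce T) h₁
        exact ((hstep a a.2 u hu u₁ hu₁).trans hreach).trans (ih v₁ hv₁ v hv)
    obtain ⟨w, hw⟩ := hne i
    obtain ⟨v, hv⟩ := hBne w
    refine (connected_iff _).2 ⟨?_, ⟨⟨v, w, hw, hv⟩⟩⟩
    rintro ⟨u, w₁, hw₁, hu⟩ ⟨v, w₂, hw₂, hv⟩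
    obtain ⟨p⟩ := (hc i).preconnected ⟨w₁, hw₁⟩ ⟨w₂, hw₂⟩
    exact hwalk _ _ p u hu v hv
  · rw [Set.disjoint_left]
    rintro v ⟨w, hw, hv⟩ ⟨w', hw', hv'⟩
    by_cases hww : w = w'
    · subst hww
      exact Set.disjoint_left.1 (hd i j hij) hw hw'
    · exact Set.disjoint_left.1 (hdisj w w' hww) hv hv'
  · obtain ⟨w, hw, w', hw', h⟩ := ha i j hij
    obtain ⟨u, hu, v, hv, huv⟩ := hadj w w' h
    exact ⟨u, ⟨w, hw, hu⟩, v, ⟨w', hw', hv⟩, huv⟩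

lemma connected_induce_singleton (G : SimpleGraph V) (v : V) : (G.induce {v}).Connected := by
  have : Nonempty ({v} : Set V) := ⟨v, rfl⟩
  exact Connected.of_subsingleton

/-- Complete minors can be pulled back along injective homomorphisms. -/
lemma HasCompleteMinor.of_injective {G : SimpleGraph V} {H : SimpleGraph W} {m : ℕ} (f : W → V)
    (hf : Function.Injective f) (hadj : ∀ w w', H.Adj w w' → G.Adj (f w) (f w'))
    (h : HasCompleteMinor H m) : HasCompleteMinor G m := by
  refine h.of_model (fun w => {f w}) (fun w => connected_induce_singleton G _) ?_ ?_
  · intro w w' hww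
    rw [Set.disjoint_singleton]
    exact fun e => hww (hf e)
  · intro w w' hww
    simpa using hadj w w' hww

lemma hasCompleteMinor_top (m : ℕ) : HasCompleteMinor (⊤ : SimpleGraph (Fin m)) m :=
  ⟨fun i => {i}, fun i => Set.singleton_nonempty i, connected_induce_singleton _,
    fun i j hij => by simpa using hij, fun i j hij => by simpa using hij⟩

/-- The graph obtained from `G` by making `v` adjacent to all neighbours of `y`. -/
def absorb (G : SimpleGraph V) (v y : V) : SimpleGraph V where
  Adj a b := a ≠ b ∧ (G.Adj a b ∨ (a = v ∧ G.Adj y b) ∨ (b = v ∧ G.Adj y a))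
  symm := ⟨fun a b ⟨h, h'⟩ => ⟨h.symm, by rw [G.adj_comm b a]; tauto⟩⟩
  loopless := ⟨fun a h => h.1 rfl⟩

lemma HasCompleteMinor.of_induce {G : SimpleGraph V} {U : Set V} {m : ℕ}
    (h : HasCompleteMinor (G.induce U) m) : HasCompleteMinor G m :=
  h.of_injective Subtype.val Subtype.val_injective fun _ _ h => h

/-- Contracting an edge `v y` and passing to a subgraph. -/
lemma HasCompleteMinor.of_absorb {G : SimpleGraph V} {v y : V} {U : Set V} {m : ℕ}
    (hvy : G.Adj v y) (hy : y ∉ U) (h : HasCompleteMinor ((absorb G v y).induce U) m) :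
    HasCompleteMinor G m := by
  classical
  have hB : ∀ w : U, w.1 ≠ y := fun w e => hy (e ▸ w.2)
  refine h.of_model (fun w => if w.1 = v then {v, y} else {w.1}) ?_ ?_ ?_
  · intro w
    by_cases e : w.1 = v
    · rw [if_pos e]
      exact induce_pair_connected_of_adj hvy
    · rw [if_neg e]
      exact connected_induce_singleton G _
  · intro w w' hww
    have hne : w.1 ≠ w'.1 := fun e => hww (Subtype.ext e)
    have h1 := hB w
    have h2 := hB w'
    rw [Set.disjoint_left]
    intro z hz hz'
    split_ifs at hz hz' <;> simp only [Set.mem_insert_iff, Set.mem_singleton_iff] at hz hz' <;>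
      grind
  · have hself : ∀ w : U, w.1 ∈ (if w.1 = v then {v, y} else {w.1} : Set V) := fun w => by
      split_ifs with e <;> simp [e]
    have hmem : ∀ w : U, w.1 = v → y ∈ (if w.1 = v then {v, y} else {w.1} : Set V) :=
      fun w e => by simp [e]
    rintro w w' ⟨-, hadj | ⟨e, hadj⟩ | ⟨e, hadj⟩⟩
    · exact ⟨w, hself w, w', hself w', hadj⟩
    · exact ⟨y, hmem w e, w', hself w', hadj⟩
    · exact ⟨w, hself w, y, hmem w' e, hadj.symm⟩

end Minors

/-! ### Counting adjacent pairs -/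

section Counting

variable {V : Type}

/-- The number of ordered pairs of adjacent vertices in `U`. -/
noncomputable def arcs (G : SimpleGraph V) (U : Finset V) : ℕ := ∑ a ∈ U, (nbrs G U a).card

lemma nbrs_mono_left {G H : SimpleGraph V} (h : ∀ a b, G.Adj a b → H.Adj a b) (U : Finset V)
    (a : V) : nbrs G U a ⊆ nbrs H U a := by
  intro b hb
  rw [mem_nbrs] at hb ⊢
  exact ⟨hb.1, h _ _ hb.2⟩

lemma arcs_mono {G H : SimpleGraph V} (h : ∀ a b, G.Adj a b → H.Adj a b) (U : Finset V) :
    arcs G U ≤ arcs H U :=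
  Finset.sum_le_sum fun a _ => Finset.card_le_card (nbrs_mono_left h U a)

lemma card_nbrs_insert [DecidableEq V] (G : SimpleGraph V) {U : Finset V} {b : V} (hb : b ∉ U)
    (a : V) [Decidable (G.Adj b a)] :
    (nbrs G (insert b U) a).card = (nbrs G U a).card + if G.Adj b a then 1 else 0 := by
  classical
  split_ifs with h
  · rw [← Finset.card_insert_of_notMem (s := nbrs G U a) (a := b) (by simp [hb])]
    congr 1
    ext c
    simp only [mem_nbrs, Finset.mem_insert]
    constructor
    · tauto
    · rintro (rfl | h')
      · exact ⟨Or.inl rfl, h.symm⟩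
      · tauto
  · rw [add_zero]
    congr 1
    ext c
    simp only [mem_nbrs, Finset.mem_insert]
    constructor
    · rintro ⟨rfl | h1, h2⟩
      · exact absurd h2.symm h
      · exact ⟨h1, h2⟩
    · tauto

lemma arcs_insert [DecidableEq V] (G : SimpleGraph V) {U : Finset V} {b : V} (hb : b ∉ U) :
    arcs G (insert b U) = arcs G U + 2 * (nbrs G U b).card := by
  classical
  rw [arcs, Finset.sum_insert hb, card_nbrs_insert G hb b, if_neg (G.irrefl),
    Finset.sum_congr rfl fun a _ => card_nbrs_insert G hb a, Finset.sum_add_distrib,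
    ← Finset.card_filter, arcs, show U.filter (fun a => G.Adj b a) = nbrs G U b by ext; simp]
  ring

lemma even_arcs (G : SimpleGraph V) (U : Finset V) : Even (arcs G U) := by
  classical
  induction U using Finset.induction_on with
  | empty => simp [arcs]
  | insert b U hb ih =>
    rw [arcs_insert G hb]
    exact ih.add (even_two_mul _)

lemma arcs_add_le_arcs_absorb (G : SimpleGraph V) {U T : Finset V} {v y : V} (hv : v ∈ U)
    (hT : ∀ z ∈ T, z ∈ U ∧ z ≠ v ∧ G.Adj y z ∧ ¬ G.Adj v z) :
    arcs G U + 2 * T.card ≤ arcs (absorb G v y) U := by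
  classical
  have hmono : ∀ a b, G.Adj a b → (absorb G v y).Adj a b := fun a b h => ⟨h.ne, Or.inl h⟩
  have hv' : v ∉ U.erase v := Finset.notMem_erase v U
  rw [← Finset.insert_erase hv, arcs_insert _ hv', arcs_insert _ hv']
  have h1 := arcs_mono hmono (U.erase v)
  have h2 : (nbrs G (U.erase v) v ∪ T).card ≤ (nbrs (absorb G v y) (U.erase v) v).card := by
    refine Finset.card_le_card fun z hz => ?_
    rw [mem_nbrs, Finset.mem_erase]
    rcases Finset.mem_union.1 hz with hz | hz
    · rw [mem_nbrs, Finset.mem_erase] at hz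
      exact ⟨hz.1, hmono _ _ hz.2⟩
    · obtain ⟨hzU, hzv, hyz, -⟩ := hT z hz
      exact ⟨⟨hzv, hzU⟩, hzv.symm, Or.inr (Or.inl ⟨rfl, hyz⟩)⟩
  rw [Finset.card_union_of_disjoint] at h2
  · omega
  · rw [Finset.disjoint_left]
    intro z hz hzT
    exact (hT z hzT).2.2.2 (mem_nbrs.1 hz).2

lemma arcs_induce (G : SimpleGraph V) (U : Finset V) :
    arcs (G.induce (U : Set V)) Finset.univ = arcs G U := by
  classical
  have h : ∀ a : (U : Set V), (nbrs (G.induce (U : Set V)) Finset.univ a).card =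
      (nbrs G U a).card := by
    intro a
    refine Finset.card_bij (fun b _ => b.1) ?_ ?_ ?_
    · intro b hb
      exact mem_nbrs.2 ⟨b.2, (mem_nbrs.1 hb).2⟩
    · intro b _ c _ e
      exact Subtype.ext e
    · intro b hb
      exact ⟨⟨b, (mem_nbrs.1 hb).1⟩, mem_nbrs.2 ⟨Finset.mem_univ _, (mem_nbrs.1 hb).2⟩, rfl⟩
  rw [arcs, arcs, Finset.sum_congr rfl fun a _ => h a]
  exact Finset.sum_coe_sort U fun a => (nbrs G U a).card

end Counting

/-! ### Vertices of low degree -/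

section LowDegree

variable {V : Type}

/-- Every graph with `n` vertices and at least `5 n - 14` edges, where `6 ≤ n < k`,
has a `K₇` minor. -/
def DenseMinorsBelow (k : ℕ) : Prop :=
  ∀ (W : Type) [Fintype W] (H : SimpleGraph W), Fintype.card W < k → 6 ≤ Fintype.card W →
    10 * Fintype.card W ≤ arcs H Finset.univ + 28 → HasCompleteMinor H 7

lemma DenseMinorsBelow.induce {k : ℕ} (h : DenseMinorsBelow k) (G : SimpleGraph V) {U : Finset V}
    (hk : U.card < k) (h6 : 6 ≤ U.card) (harcs : 10 * U.card ≤ arcs G U + 28) :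
    HasCompleteMinor (G.induce (U : Set V)) 7 := by
  have hc : Fintype.card (U : Set V) = U.card := by simp
  refine h _ _ ?_ ?_ ?_
  · rwa [hc]
  · rwa [hc]
  · rwa [hc, arcs_induce]

/-- `K` is a nonempty set of vertices outside the closed neighbourhood of `x`, all of whose outside
neighbours are neighbours of `x`. -/
def IsCutOffBy (G : SimpleGraph V) (x : V) (K : Finset V) : Prop :=
  K.Nonempty ∧ (∀ w ∈ K, w ≠ x ∧ ¬ G.Adj x w) ∧ ∀ w ∈ K, ∀ z, G.Adj w z → z ∈ K ∨ G.Adj x z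

open Classical in
lemma IsCutOffBy.exists_degree_le [Fintype V] {G : SimpleGraph V} {x : V} {K : Finset V}
    (hK : IsCutOffBy G x K) (hx : (nbrs G Finset.univ x).card ≤ 9)
    (htri : ∀ a b, G.Adj a b → 5 ≤ (nbrs G Finset.univ a ∩ nbrs G Finset.univ b).card)
    (hdense : DenseMinorsBelow (Fintype.card V)) (hG : ¬ HasCompleteMinor G 7) :
    ∃ u ∈ K, (nbrs G Finset.univ u).card ≤ 9 := by
  by_contra! hcon
  obtain ⟨⟨w₀, hw₀⟩, hfar, hcl⟩ := hK
  set N := Finset.univ.filter fun v => G.Adj x v ∧ ∃ w ∈ K, G.Adj w v with hNdef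
  have hN : ∀ v, v ∈ N ↔ G.Adj x v ∧ ∃ w ∈ K, G.Adj w v := fun v => by simp [hNdef]
  set U := K ∪ N with hUdef
  have hxU : x ∉ U := by
    rw [hUdef, Finset.mem_union, hN]
    rintro (h | h)
    · exact (hfar x h).1 rfl
    · exact G.irrefl h.1
  have hdisj : Disjoint K N := by
    rw [Finset.disjoint_left]
    exact fun w hw hwN => (hfar w hw).2 ((hN w).1 hwN).1
  have hUcard : U.card = K.card + N.card := Finset.card_union_of_disjoint hdisj
  have hUlt : U.card < Fintype.card V := Finset.card_lt_univ_of_notMem hxU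
  have hKU : ∀ w ∈ K, ∀ z, G.Adj w z → z ∈ U := by
    intro w hw z hz
    rw [hUdef, Finset.mem_union, hN]
    exact (hcl w hw z hz).imp_right fun h => ⟨h, w, hw, hz⟩
  have hKdeg : ∀ w ∈ K, 10 ≤ (nbrs G U w).card := by
    intro w hw
    refine le_trans (hcon w hw) (Finset.card_le_card fun z hz => ?_)
    rw [mem_nbrs] at hz ⊢
    exact ⟨hKU w hw z hz.2, hz.2⟩
  have hN9 : N.card ≤ 9 := by
    refine le_trans (Finset.card_le_card fun z hz => ?_) hx
    exact mem_nbrs.2 ⟨Finset.mem_univ _, ((hN z).1 hz).1⟩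
  have hU6 : 6 ≤ U.card := by
    have h1 : nbrs G U w₀ ⊆ U := fun z hz => (mem_nbrs.1 hz).1
    have h2 := Finset.card_le_card h1
    have h3 := hKdeg w₀ hw₀
    omega
  have hNdeg : ∀ v ∈ N, 6 ≤ (nbrs G U v).card := by
    intro v hv
    obtain ⟨-, w, hw, hwv⟩ := (hN v).1 hv
    have hsub : insert w (nbrs G Finset.univ w ∩ nbrs G Finset.univ v) ⊆ nbrs G U v := by
      intro z hz
      simp only [Finset.mem_insert, Finset.mem_inter, mem_nbrs, Finset.mem_univ, true_and] at hz ⊢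
      rcases hz with rfl | hz
      · exact ⟨Finset.mem_union_left _ hw, hwv.symm⟩
      · exact ⟨hKU w hw z hz.1, hz.2⟩
    have h := Finset.card_le_card hsub
    rw [Finset.card_insert_of_notMem (by simp)] at h
    have := htri w v hwv
    omega
  have hNdeg' : ∀ v ∈ N, (nbrs G N v).card + 1 ≤ (nbrs G U v).card := by
    intro v hv
    obtain ⟨-, w, hw, hwv⟩ := (hN v).1 hv
    have hwN : w ∉ N := Finset.disjoint_left.1 hdisj hw
    rw [← Finset.card_insert_of_notMem (s := nbrs G N v) (a := w) (by simp [hwN])]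
    refine Finset.card_le_card fun z hz => ?_
    simp only [Finset.mem_insert, mem_nbrs] at hz ⊢
    rcases hz with rfl | hz
    · exact ⟨Finset.mem_union_left _ hw, hwv.symm⟩
    · exact ⟨Finset.mem_union_right _ hz.1, hz.2⟩
  have harcs : arcs G U = ∑ w ∈ K, (nbrs G U w).card + ∑ v ∈ N, (nbrs G U v).card :=
    Finset.sum_union hdisj
  have hsumK := Finset.card_nsmul_le_sum K _ 10 hKdeg
  have hsumN := Finset.card_nsmul_le_sum N _ 6 hNdeg
  have hsumN' : ∑ v ∈ N, ((nbrs G N v).card + 1) ≤ ∑ v ∈ N, (nbrs G U v).card :=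
    Finset.sum_le_sum hNdeg'
  rw [Finset.sum_add_distrib, Finset.sum_const, ← arcs] at hsumN'
  simp only [smul_eq_mul, mul_one] at hsumK hsumN hsumN'
  have hsparse : arcs G U + 28 < 10 * U.card := by
    by_contra! h
    exact hG (hdense.induce G hUlt hU6 h).of_induce
  have hsparse' : ∀ v ∈ N, arcs G U + 2 * (N.card - 1 - (nbrs G N v).card) + 28 < 10 * U.card := by
    intro v hv
    have hv' := (hN v).1 hv
    have hsub : insert v (nbrs G N v) ⊆ N := by
      intro z hz
      simp only [Finset.mem_insert, mem_nbrs] at hz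
      rcases hz with rfl | hz
      exacts [hv, hz.1]
    have hT := Finset.card_sdiff_add_card_eq_card hsub
    rw [Finset.card_insert_of_notMem (by simp)] at hT
    have h1 := arcs_add_le_arcs_absorb G (U := U) (T := N \ insert v (nbrs G N v)) (v := v) (y := x)
      (Finset.mem_union_right _ hv) (by
        intro z hz
        simp only [Finset.mem_sdiff, Finset.mem_insert, mem_nbrs, not_or, not_and] at hz
        exact ⟨Finset.mem_union_right _ hz.1, hz.2.1, ((hN z).1 hz.1).1, hz.2.2 hz.1⟩)
    by_contra! h
    exact hG ((hdense.induce (absorb G v x) hUlt hU6 (by omega)).of_absorb hv'.1.symm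
      (by simpa using hxU))
  have hNne : N.Nonempty := by
    rw [← Finset.card_pos]
    omega
  obtain ⟨v, hv, hmin⟩ := Finset.exists_min_image N (fun v => (nbrs G N v).card) hNne
  have hmin' := Finset.card_nsmul_le_sum N _ _ hmin
  rw [smul_eq_mul, ← arcs] at hmin'
  have hv' := hsparse' v hv
  obtain ⟨p, hp⟩ := even_arcs G U
  obtain ⟨q, hq⟩ := even_arcs G N
  obtain h | h | h : N.card ≤ 7 ∨ N.card = 8 ∨ N.card = 9 := by omega
  · omega
  · rw [h] at hmin' hsumN' hsumN hv' hUcard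
    omega
  · rw [h] at hmin' hsumN' hsumN hv' hUcard
    omega

open Classical in
/-- A graph all of whose edges lie in five triangles has a `K₇` minor if it has a vertex of
degree at most `9`. -/
lemma hasCompleteMinor_of_degree_le [Fintype V] {G : SimpleGraph V}
    (htri : ∀ a b, G.Adj a b → 5 ≤ (nbrs G Finset.univ a ∩ nbrs G Finset.univ b).card)
    (hpos : ∀ a, 0 < (nbrs G Finset.univ a).card) (hlow : ∃ x, (nbrs G Finset.univ x).card ≤ 9)
    (hdense : DenseMinorsBelow (Fintype.card V)) : HasCompleteMinor G 7 := by
  by_contra hG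
  by_cases hex : ∃ n x K, (nbrs G Finset.univ x).card ≤ 9 ∧ IsCutOffBy G x K ∧ K.card = n
  · obtain ⟨x, K, hx, hK, hKn⟩ := Nat.find_spec hex
    have hKmin : ∀ y L, (nbrs G Finset.univ y).card ≤ 9 → IsCutOffBy G y L → K.card ≤ L.card :=
      fun y L hy hL => hKn ▸ Nat.find_min' hex ⟨y, L, hy, hL, rfl⟩
    obtain ⟨u₀, hu₀, hu₀9⟩ := hK.exists_degree_le hx htri hdense hG
    obtain ⟨hKne, hfar, hcl⟩ := hK
    obtain ⟨u, hu, humin⟩ := Finset.exists_min_image K (fun u => (nbrs G Finset.univ u).card) hKne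
    have hu9 : (nbrs G Finset.univ u).card ≤ 9 := (humin u₀ hu₀).trans hu₀9
    have hux : ¬ G.Adj u x := fun h => (hfar u hu).2 h.symm
    have hxconn : (G.induce (({x} : Finset V) : Set V)).Connected := by
      rw [Finset.coe_singleton]
      exact connected_induce_singleton G x
    have hxsing : ({x} : Finset V) ∈ Finset.univ.filter fun D : Finset V =>
        x ∈ D ∧ (G.induce (D : Set V)).Connected ∧ ∀ d ∈ D, d ≠ u ∧ ¬ G.Adj u d := by
      simp only [Finset.mem_filter, Finset.mem_univ, true_and, Finset.mem_singleton,
        forall_eq]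
      exact ⟨hxconn, (hfar u hu).1.symm, hux⟩
    obtain ⟨D, hD, hDmax⟩ := Finset.exists_max_image _ Finset.card ⟨_, hxsing⟩
    simp only [Finset.mem_filter, Finset.mem_univ, true_and] at hD hDmax
    obtain ⟨hxD, hDconn, hDu⟩ := hD
    have hDcl : ∀ d ∈ D, ∀ z, G.Adj d z → z ≠ u → ¬ G.Adj u z → z ∈ D := by
      intro d hd z hdz hzu huz
      by_contra hzD
      have h := hDmax (insert z D) ⟨Finset.mem_insert_of_mem hxD, by
          rw [Finset.coe_insert, Set.insert_eq]
          exact connected_induce_union (connected_induce_singleton G z).preconnected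
            hDconn.preconnected rfl hd hdz.symm, by
          intro e he
          rcases Finset.mem_insert.1 he with rfl | he
          exacts [⟨hzu, huz⟩, hDu e he]⟩
      rw [Finset.card_insert_of_notMem hzD] at h
      omega
    have hKD : ∀ w ∈ K, w ≠ u → ¬ G.Adj u w → w ∈ D := by
      by_contra! hcon
      obtain ⟨w₀, hw₀, hw₀u, huw₀, hw₀D⟩ := hcon
      let K' := K.filter fun w => w ≠ u ∧ ¬ G.Adj u w ∧ w ∉ D
      have hK' : IsCutOffBy G u K' := by
        refine ⟨⟨w₀, by simp [K', *]⟩, fun w hw => ?_, fun w hw z hwz => ?_⟩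
        · have h := (Finset.mem_filter.1 hw).2
          exact ⟨h.1, h.2.1⟩
        · obtain ⟨hwK, hwu, huw, hwD⟩ := Finset.mem_filter.1 hw
          by_contra! hcon
          have hzu : z ≠ u := fun e => huw (e ▸ hwz.symm)
          have hzD : z ∉ D := fun h => hwD (hDcl z h w hwz.symm hwu huw)
          rcases hcl w hwK z hwz with hz | hz
          · exact hcon.1 (Finset.mem_filter.2 ⟨hz, hzu, hcon.2, hzD⟩)
          · exact hzD (hDcl x hxD z hz hzu hcon.2)
      have hlt : K'.card < K.card :=
        Finset.card_lt_card ⟨Finset.filter_subset _ _, fun h =>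
          (Finset.mem_filter.1 (h hu)).2.1 rfl⟩
      exact absurd (hKmin u K' hu9 hK') (by omega)
    refine hG (hasCompleteMinor_of_neighborhood (D := (D : Set V)) (hpos u) hu9 (htri u) hDconn
      (fun h => (hDu u h).1 rfl) (fun v hv => (hDu v hv).2) fun v w huv huw hvw hnvw => ?_)
    by_cases hxv : G.Adj x v
    · exact ⟨x, hxD, hxv.symm⟩
    have hvK : v ∈ K := (hcl u hu v huv).resolve_right hxv
    obtain ⟨z, hvz, hzu, huz⟩ : ∃ z, G.Adj v z ∧ z ≠ u ∧ ¬ G.Adj u z := by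
      by_contra! hcon
      have hsub : nbrs G Finset.univ v ⊆ insert u (((nbrs G Finset.univ u).erase w).erase v) := by
        intro z hz
        have hvz := (mem_nbrs.1 hz).2
        simp only [Finset.mem_insert, Finset.mem_erase, mem_nbrs, Finset.mem_univ, true_and]
        by_cases hzu : z = u
        · exact Or.inl hzu
        · exact Or.inr ⟨hvz.ne', fun e => hnvw (e ▸ hvz), hcon z hvz hzu⟩
      have h1 := (Finset.card_le_card hsub).trans (Finset.card_insert_le _ _)
      have h2 : w ∈ nbrs G Finset.univ u := by simp [huw]
      have h3 : v ∈ (nbrs G Finset.univ u).erase w := by simp [huv, hvw]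
      have h4 := Finset.card_erase_add_one h2
      have h5 := Finset.card_erase_add_one h3
      have h6 := humin v hvK
      omega
    refine ⟨z, ?_, hvz⟩
    rcases hcl v hvK z hvz with hz | hz
    · exact hKD z hz hzu huz
    · exact hDcl x hxD z hz hzu huz
  · push Not at hex
    obtain ⟨x₀, hx₀⟩ := hlow
    obtain ⟨x, -, hmin⟩ := Finset.exists_min_image Finset.univ
      (fun x => (nbrs G Finset.univ x).card) ⟨x₀, Finset.mem_univ _⟩
    have hx : (nbrs G Finset.univ x).card ≤ 9 := (hmin x₀ (Finset.mem_univ _)).trans hx₀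
    have hdom : ∀ w, w ≠ x → G.Adj x w := by
      by_contra! hcon
      obtain ⟨w, hwx, hxw⟩ := hcon
      refine hex _ x (Finset.univ.filter fun w => w ≠ x ∧ ¬ G.Adj x w) hx
        ⟨⟨w, by simp [hwx, hxw]⟩, fun w hw => by simpa using hw, fun w hw z hwz => ?_⟩ rfl
      simp only [Finset.mem_filter, Finset.mem_univ, true_and] at hw ⊢
      by_contra! hcon
      by_cases hzx : z = x
      · subst hzx
        exact hw.2 hwz.symm
      · exact hcon.2 (hcon.1 hzx)
    have hcomplete : ∀ a b, a ≠ b → G.Adj a b := by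
      intro a b hab
      have h1 : Finset.univ.erase x ⊆ nbrs G Finset.univ x := fun w hw => by
        simpa using hdom w (Finset.ne_of_mem_erase hw)
      have h2 : nbrs G Finset.univ a ⊆ Finset.univ.erase a := fun w hw => by
        have := (mem_nbrs.1 hw).2.ne'
        simpa using this
      have h3 := (Finset.card_le_card h1).trans (hmin a (Finset.mem_univ _))
      have h4 := Finset.eq_of_subset_of_card_le h2 (by
        simpa only [Finset.card_erase_of_mem (Finset.mem_univ _)] using h3)
      have h5 : b ∈ nbrs G Finset.univ a := by rw [h4]; simpa using hab.symm
      exact (mem_nbrs.1 h5).2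
    obtain ⟨b, hb⟩ := Finset.card_pos.1 (hpos x)
    have hxb := (mem_nbrs.1 hb).2
    have hcard : 7 ≤ Fintype.card V := by
      have h1 := htri x b hxb
      have h2 := Finset.card_le_univ
        (insert x (insert b (nbrs G Finset.univ x ∩ nbrs G Finset.univ b)))
      rw [Finset.card_insert_of_notMem (by simp [hxb.ne]),
        Finset.card_insert_of_notMem (by simp)] at h2
      omega
    obtain ⟨f⟩ := Function.Embedding.nonempty_of_card_le
      (show Fintype.card (Fin 7) ≤ Fintype.card V by simpa using hcard)
    exact hG ((hasCompleteMinor_top 7).of_injective f f.injective fun i j hij =>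
      hcomplete _ _ (f.injective.ne hij))

end LowDegree

/-! ### Dense graphs -/

section Dense

variable {V : Type}

lemma arcs_congr {G H : SimpleGraph V} {U : Finset V}
    (h : ∀ a ∈ U, ∀ b ∈ U, (G.Adj a b ↔ H.Adj a b)) : arcs G U = arcs H U := by
  refine Finset.sum_congr rfl fun a ha => ?_
  congr 1
  ext b
  simp only [mem_nbrs]
  exact and_congr_right fun hb => h a ha b hb

lemma exists_delete_edge {G : SimpleGraph V} {U : Finset V} {a b : V} (ha : a ∈ U) (hb : b ∈ U)
    (hab : G.Adj a b) :
    ∃ H : SimpleGraph V, (∀ u v, H.Adj u v → G.Adj u v) ∧ arcs H U + 2 = arcs G U := by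
  classical
  refine ⟨G.deleteEdges {s(a, b)}, fun u v h => (deleteEdges_adj.1 h).1, ?_⟩
  have ha' : a ∉ U.erase a := Finset.notMem_erase a U
  have hb' : b ∈ nbrs G (U.erase a) a := by simp [hab, hb, hab.ne']
  have h1 : nbrs (G.deleteEdges {s(a, b)}) (U.erase a) a = (nbrs G (U.erase a) a).erase b := by
    ext z
    simp only [mem_nbrs, Finset.mem_erase, deleteEdges_adj, Set.mem_singleton_iff,
      Sym2.congr_right]
    tauto
  have h2 : arcs (G.deleteEdges {s(a, b)}) (U.erase a) = arcs G (U.erase a) := by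
    refine arcs_congr fun u hu v hv => ?_
    have h : s(u, v) ≠ s(a, b) := by
      have := Finset.ne_of_mem_erase hu
      have := Finset.ne_of_mem_erase hv
      rw [Ne, Sym2.eq_iff]
      tauto
    simp [deleteEdges_adj, h]
  have h3 := Finset.card_erase_add_one hb'
  rw [← Finset.insert_erase ha, arcs_insert _ ha', arcs_insert _ ha', h1, h2]
  omega

lemma arcs_univ_le [Fintype V] (G : SimpleGraph V) :
    arcs G Finset.univ ≤ Fintype.card V * (Fintype.card V - 1) := by
  classical
  refine (Finset.sum_le_card_nsmul Finset.univ _ (Fintype.card V - 1) fun a _ => ?_).trans_eq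
    (by simp)
  rw [← Finset.card_univ, ← Finset.card_erase_of_mem (Finset.mem_univ a)]
  refine Finset.card_le_card fun b hb => ?_
  simpa using (mem_nbrs.1 hb).2.ne'

lemma DenseMinorsBelow.hasCompleteMinor [Fintype V] (hdense : DenseMinorsBelow (Fintype.card V))
    (h6 : 6 ≤ Fintype.card V) (n : ℕ) (G : SimpleGraph V) (hn : arcs G Finset.univ = n)
    (harcs : 10 * Fintype.card V ≤ arcs G Finset.univ + 28) : HasCompleteMinor G 7 := by
  classical
  induction n using Nat.strong_induction_on generalizing G with
  | _ n ih =>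
  have h7 : 7 ≤ Fintype.card V := by
    by_contra! h
    have h1 : Fintype.card V = 6 := by omega
    have h2 := arcs_univ_le G
    rw [h1] at h2 harcs
    omega
  have hErase : ∀ y : V, (Finset.univ.erase y).card + 1 = Fintype.card V := fun y =>
    Finset.card_erase_add_one (Finset.mem_univ y)
  have hnbrs : ∀ y, nbrs G (Finset.univ.erase y) y = nbrs G Finset.univ y := fun y => by
    ext z
    simpa using fun h : G.Adj y z => h.ne'
  have hdel : ∀ y, arcs G Finset.univ =
      arcs G (Finset.univ.erase y) + 2 * (nbrs G Finset.univ y).card := fun y => by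
    rw [← hnbrs y, ← arcs_insert G (Finset.notMem_erase y _),
      Finset.insert_erase (Finset.mem_univ y)]
  by_cases hlow : ∃ y, (nbrs G Finset.univ y).card ≤ 5
  · obtain ⟨y, hy⟩ := hlow
    have h1 := hErase y
    have h2 := hdel y
    exact (hdense.induce G (U := Finset.univ.erase y) (by omega) (by omega) (by omega)).of_induce
  push Not at hlow
  by_cases htri : ∀ a b, G.Adj a b → 5 ≤ (nbrs G Finset.univ a ∩ nbrs G Finset.univ b).card
  · by_cases hdeg : ∃ x, (nbrs G Finset.univ x).card ≤ 9
    · exact hasCompleteMinor_of_degree_le htri (fun a => by have := hlow a; omega) hdeg hdense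
    · push Not at hdeg
      have h1 := Finset.card_nsmul_le_sum Finset.univ _ 10 fun a _ => hdeg a
      rw [← arcs, smul_eq_mul, Finset.card_univ] at h1
      have : Nonempty V := Fintype.card_pos_iff.1 (by omega)
      obtain ⟨a⟩ := this
      have h2 := hdeg a
      obtain ⟨b, hb⟩ := Finset.card_pos.1 (show 0 < (nbrs G Finset.univ a).card by omega)
      obtain ⟨H, hHG, hH⟩ := exists_delete_edge (Finset.mem_univ a) (Finset.mem_univ b)
        (mem_nbrs.1 hb).2
      exact (ih (arcs H Finset.univ) (by omega) H rfl (by omega)).of_injective id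
        Function.injective_id hHG
  · push Not at htri
    obtain ⟨a, b, hab, hcommon⟩ := htri
    let T := (nbrs G Finset.univ b).erase a \ nbrs G Finset.univ a
    have h1 := hErase b
    have h2 := hdel b
    have h3 := arcs_add_le_arcs_absorb G (U := Finset.univ.erase b) (T := T) (v := a) (y := b)
      (by simp [hab.ne]) (by
        intro z hz
        simp only [T, Finset.mem_sdiff, Finset.mem_erase, mem_nbrs, Finset.mem_univ,
          true_and] at hz ⊢
        exact ⟨⟨hz.1.2.ne', trivial⟩, hz.1.1, hz.1.2, hz.2⟩)
    have h4 : (nbrs G Finset.univ b).card ≤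
        T.card + 1 + (nbrs G Finset.univ a ∩ nbrs G Finset.univ b).card := by
      have hsub : nbrs G Finset.univ b ⊆
          insert a T ∪ (nbrs G Finset.univ a ∩ nbrs G Finset.univ b) := by
        intro z hz
        simp only [T, Finset.mem_union, Finset.mem_insert, Finset.mem_sdiff, Finset.mem_erase,
          Finset.mem_inter]
        tauto
      refine (Finset.card_le_card hsub).trans ((Finset.card_union_le _ _).trans ?_)
      have := Finset.card_insert_le a T
      omega
    exact (hdense.induce (absorb G a b) (U := Finset.univ.erase b) (by omega) (by omega)
      (by omega)).of_absorb hab (by simp)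

/-- Mader's theorem: a graph on `n ≥ 6` vertices with at least `5 n - 14` edges has a
`K₇` minor. -/
lemma denseMinorsBelow (k : ℕ) : DenseMinorsBelow k := by
  induction k with
  | zero => exact fun W _ H h => absurd h (Nat.not_lt_zero _)
  | succ k ih =>
    intro W _ H hk h6 harcs
    by_cases h : Fintype.card W < k
    · exact ih W H h h6 harcs
    · have hW : Fintype.card W = k := by omega
      subst hW
      exact ih.hasCompleteMinor h6 _ H rfl harcs

end Dense

/-! ### Colourings -/

section Colorings

variable {V : Type} {G : SimpleGraph V}

lemma Colorable.of_induce_compl_singleton {v : V} {n : ℕ} (hv : ∀ w, ¬ G.Adj v w)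
    (h : (G.induce ({v}ᶜ : Set V)).Colorable (n + 1)) : G.Colorable (n + 1) := by
  classical
  obtain ⟨C⟩ := h
  refine ⟨Coloring.mk (fun w => if hw : w ∈ ({v}ᶜ : Set V) then C ⟨w, hw⟩ else 0) ?_⟩
  intro a b hab
  have ha : a ∈ ({v}ᶜ : Set V) := by rintro rfl; exact hv _ hab
  have hb : b ∈ ({v}ᶜ : Set V) := by rintro rfl; exact hv _ hab.symm
  simp only [dif_pos ha, dif_pos hb]
  exact C.valid hab

open Classical in
/-- In a graph that is not `(n + 1)`-colourable, any colour of an `n`-colouring of `G - x - y`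
occurs on a common neighbour of `x` and `y`. -/
lemma le_card_common_nbrs [Fintype V] {x y : V} {n : ℕ} (hG : ¬ G.Colorable (n + 1))
    (h : (G.induce ({x, y}ᶜ : Set V)).Colorable n) :
    n ≤ (nbrs G Finset.univ x ∩ nbrs G Finset.univ y).card := by
  obtain ⟨C⟩ := h
  have hcolor : ∀ c : Fin n, ∃ z : ({x, y}ᶜ : Set V), C z = c ∧ G.Adj x z ∧ G.Adj y z := by
    intro c
    by_contra! hcon
    let C' : V → Fin n := fun z => if hz : z ∈ ({x, y}ᶜ : Set V) then C ⟨z, hz⟩ else c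
    have hC' : ∀ z w, z ≠ x → z ≠ y → w ≠ x → w ≠ y → G.Adj z w → C' z ≠ C' w := by
      intro z w hzx hzy hwx hwy hzw
      have hz : z ∈ ({x, y}ᶜ : Set V) := by simp [hzx, hzy]
      have hw : w ∈ ({x, y}ᶜ : Set V) := by simp [hwx, hwy]
      simp only [C', dif_pos hz, dif_pos hw]
      exact C.valid hzw
    have hcon' : ∀ z, z ≠ x → z ≠ y → C' z = c → G.Adj x z → ¬ G.Adj y z := by
      intro z hzx hzy hzc
      have hz : z ∈ ({x, y}ᶜ : Set V) := by simp [hzx, hzy]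
      simp only [C', dif_pos hz] at hzc
      exact hcon ⟨z, hz⟩ hzc
    have hcol : G.Coloring (Option (Fin n)) := Coloring.mk
      (fun z => if z = x then some c else if z = y ∨ C' z = c ∧ G.Adj x z then none
        else some (C' z)) (by
      intro z w hzw
      have h1 := hC' z w
      have h2 := hcon' z
      have h3 := hcon' w
      have h4 := hzw.ne
      have h5 := hzw.symm
      grind)
    exact hG (by simpa using hcol.colorable)
  choose f hf hxf hyf using hcolor
  have hcard := Finset.card_le_card_of_injOn (s := Finset.univ)
    (t := nbrs G Finset.univ x ∩ nbrs G Finset.univ y) (fun c => (f c : V))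
    (fun c _ => by simp [hxf c, hyf c])
    (fun c _ d _ e => by rw [← hf c, ← hf d, Subtype.ext e])
  simpa using hcard

end Colorings

/-- Every double-critical `7`-chromatic graph contains `K₇` as a minor. -/
theorem stmt17 {V : Type} [Fintype V] (G : SimpleGraph V)
    (hdc : DoubleCritical G) (hchrom : G.chromaticNumber = 7) :
    HasCompleteMinor G 7 := by
  classical
  obtain ⟨hvc, hdc⟩ := hdc
  have hG : ¬ G.Colorable 6 := fun h => by
    have h1 := chromaticNumber_le_iff_colorable.2 h
    rw [hchrom] at h1
    exact absurd h1 (by decide)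
  have htri : ∀ a b, G.Adj a b →
      5 ≤ (nbrs G Finset.univ a ∩ nbrs G Finset.univ b).card := by
    intro a b hab
    refine le_card_common_nbrs hG (chromaticNumber_le_iff_colorable.1 ?_)
    have h := hdc a b hab
    rw [hchrom, show (7 : ℕ∞) = 5 + 2 by norm_num] at h
    exact (ENat.add_le_add_iff_right (by decide)).1 h
  have hpos : ∀ a, 0 < (nbrs G Finset.univ a).card := by
    intro a
    by_contra! h
    have ha : ∀ w, ¬ G.Adj a w := fun w hw => by
      have := Finset.card_pos.2 ⟨w, mem_nbrs.2 ⟨Finset.mem_univ w, hw⟩⟩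
      omega
    refine hG (Colorable.of_induce_compl_singleton ha (chromaticNumber_le_iff_colorable.1 ?_))
    have h := hvc a
    rw [hchrom, show (7 : ℕ∞) = 6 + 1 by norm_num] at h
    exact Order.le_of_lt_add_one h
  by_cases hlow : ∃ x, (nbrs G Finset.univ x).card ≤ 9
  · exact hasCompleteMinor_of_degree_le htri hpos hlow (denseMinorsBelow _)
  push Not at hlow
  have h1 := Finset.card_nsmul_le_sum Finset.univ _ 10 fun a _ => hlow a
  rw [← arcs, smul_eq_mul, Finset.card_univ] at h1
  have hne : Nonempty V := by
    by_contra! hV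
    exact hG (Colorable.of_isEmpty 6)
  obtain ⟨x⟩ := hne
  have h2 := hlow x
  have h3 := Finset.card_le_univ (nbrs G Finset.univ x)
  exact denseMinorsBelow _ V G (Nat.lt_succ_self _) (by omega) (by omega)
end

section
/- Every double-critical k-chromatic graph with k ≥ 7 contains K₇ as a minor. -/
open SimpleGraph

namespace CompleteMinor

open Classical Finset

variable {V : Type} {G G' : SimpleGraph V} {W W' S T : Finset V}

/-- `S` is non-empty and induces a connected subgraph, in terms of cuts. -/
def ConnOn (G : SimpleGraph V) (S : Finset V) : Prop :=
  S.Nonempty ∧ ∀ T ⊆ S, T.Nonempty → (∀ u ∈ T, ∀ v ∈ S, G.Adj u v → v ∈ T) → S ⊆ T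

/-- The subgraph induced on `W` contains `K_p` as a minor. -/
def HasMinorOn (G : SimpleGraph V) (W : Finset V) (p : ℕ) : Prop :=
  ∃ f : Fin p → Finset V, (∀ i, f i ⊆ W) ∧ (∀ i, ConnOn G (f i)) ∧
    (∀ i j, i ≠ j → Disjoint (f i) (f j)) ∧
    (∀ i j, i ≠ j → ∃ u ∈ f i, ∃ v ∈ f j, G.Adj u v)

/-- The neighbours of `v` inside `W`. -/
noncomputable def nb (G : SimpleGraph V) (W : Finset V) (v : V) : Finset V :=
  {u ∈ W | G.Adj v u}

/-- Twice the number of edges of the subgraph induced on `W`. -/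
noncomputable def dens (G : SimpleGraph V) (W : Finset V) : ℕ :=
  #{p ∈ W ×ˢ W | G.Adj p.1 p.2}

lemma mem_nb {u v : V} : u ∈ nb G W v ↔ u ∈ W ∧ G.Adj v u := by simp [nb]

lemma nb_subset {v : V} : nb G W v ⊆ W := filter_subset _ _

lemma ConnOn.connected (h : ConnOn G S) : (G.induce (S : Set V)).Connected := by
  obtain ⟨⟨x, hx⟩, hS⟩ := h
  have key : ∀ u : (S : Set V), ∀ v : (S : Set V), (G.induce (S : Set V)).Reachable u v := by
    intro u v
    have := hS {z ∈ S | ∃ hz : z ∈ (S : Set V), (G.induce (S : Set V)).Reachable u ⟨z, hz⟩}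
      (filter_subset _ _) ⟨u, by
        simp only [mem_filter]
        exact ⟨u.2, u.2, SimpleGraph.Reachable.refl _⟩⟩ (by
        intro a ha b hb hab
        simp only [mem_filter] at ha ⊢
        obtain ⟨_, h1, h2⟩ := ha
        refine ⟨hb, hb, h2.trans ?_⟩
        exact SimpleGraph.Adj.reachable (by simpa using hab)) v.2
    simp only [mem_filter] at this
    obtain ⟨_, _, h⟩ := this
    exact h
  have : Nonempty (S : Set V) := ⟨⟨x, hx⟩⟩
  exact ⟨key⟩

lemma HasMinorOn.hasCompleteMinor {p : ℕ} (h : HasMinorOn G W p) : HasCompleteMinor G p := by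
  obtain ⟨f, -, hc, hd, ha⟩ := h
  refine ⟨fun i => f i, fun i => by simpa using (hc i).1, fun i => (hc i).connected,
    fun i j hij => by simpa using hd i j hij, fun i j hij => by simpa using ha i j hij⟩

lemma ConnOn.mono (hG : G ≤ G') (h : ConnOn G S) : ConnOn G' S :=
  ⟨h.1, fun T hT hne hcl => h.2 T hT hne fun u hu v hv huv => hcl u hu v hv (hG huv)⟩

lemma HasMinorOn.mono_graph {p : ℕ} (hG : G ≤ G') (h : HasMinorOn G W p) :
    HasMinorOn G' W p := by
  obtain ⟨f, hW, hc, hd, ha⟩ := h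
  refine ⟨f, hW, fun i => (hc i).mono hG, hd, fun i j hij => ?_⟩
  obtain ⟨u, hu, v, hv, huv⟩ := ha i j hij
  exact ⟨u, hu, v, hv, hG huv⟩

lemma HasMinorOn.mono {p : ℕ} (hW : W ⊆ W') (h : HasMinorOn G W p) : HasMinorOn G W' p := by
  obtain ⟨f, hf, h⟩ := h
  exact ⟨f, fun i => (hf i).trans hW, h⟩

lemma connOn_singleton (v : V) : ConnOn G {v} := by
  refine ⟨singleton_nonempty v, fun T hT hne _ => ?_⟩
  rcases subset_singleton_iff.1 hT with rfl | rfl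
  · simp at hne
  · rfl

lemma ConnOn.insert {v w : V} (h : ConnOn G S) (hw : w ∈ S) (hvw : G.Adj v w) :
    ConnOn G (insert v S) := by
  refine ⟨insert_nonempty _ _, fun T hT hne hcl => ?_⟩
  have hwT : w ∈ T := by
    by_cases hv : v ∈ T
    · exact hcl v hv w (mem_insert_of_mem hw) hvw
    · have hTS : T ⊆ S := fun z hz => by
        rcases mem_insert.1 (hT hz) with rfl | h'
        · exact absurd hz hv
        · exact h'
      exact h.2 T hTS hne (fun a ha b hb => hcl a ha b (mem_insert_of_mem hb)) hw
  have hST : S ⊆ T := fun z hz => by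
    have := h.2 (T ∩ S) inter_subset_right ⟨w, mem_inter.2 ⟨hwT, hw⟩⟩ (fun a ha b hb hab =>
      mem_inter.2 ⟨hcl a (mem_inter.1 ha).1 b (mem_insert_of_mem hb) hab, hb⟩) hz
    exact (mem_inter.1 this).1
  exact insert_subset (hcl w hwT v (mem_insert_self _ _) hvw.symm) hST

/-- The component of `x` in the subgraph induced on `A`. -/
lemma exists_component (G : SimpleGraph V) {A : Finset V} {x : V} (hx : x ∈ A) :
    ∃ K ⊆ A, x ∈ K ∧ ConnOn G K ∧ ∀ u ∈ K, ∀ v ∈ A, G.Adj u v → v ∈ K := by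
  let K : Finset V :=
    {z ∈ A | ∀ T ⊆ A, x ∈ T → (∀ u ∈ T, ∀ v ∈ A, G.Adj u v → v ∈ T) → z ∈ T}
  have hmem : ∀ z, z ∈ K ↔ z ∈ A ∧
      ∀ T ⊆ A, x ∈ T → (∀ u ∈ T, ∀ v ∈ A, G.Adj u v → v ∈ T) → z ∈ T := by
    simp [K]
  have hxK : x ∈ K := (hmem x).2 ⟨hx, fun T _ h _ => h⟩
  have hKA : K ⊆ A := filter_subset _ _
  have hcl : ∀ u ∈ K, ∀ v ∈ A, G.Adj u v → v ∈ K := fun u hu v hv huv =>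
    (hmem v).2 ⟨hv, fun T hT hxT hT' => hT' u (((hmem u).1 hu).2 T hT hxT hT') v hv huv⟩
  refine ⟨K, hKA, hxK, ⟨⟨x, hxK⟩, fun T hT hne hTcl => ?_⟩, hcl⟩
  by_cases hxT : x ∈ T
  · exact fun z hz => ((hmem z).1 hz).2 T (hT.trans hKA) hxT fun u hu v hv huv =>
      hTcl u hu v (hcl u (hT hu) v hv huv) huv
  · exfalso
    obtain ⟨t, ht⟩ := hne
    have := ((hmem t).1 (hT ht)).2 (K \ T) (sdiff_subset.trans hKA)
      (mem_sdiff.2 ⟨hxK, hxT⟩) fun u hu v hv huv => by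
        have hu' := mem_sdiff.1 hu
        have hvK := hcl u hu'.1 v hv huv
        exact mem_sdiff.2 ⟨hvK, fun hvT => hu'.2 (hTcl v hvT u hu'.1 huv.symm)⟩
    exact (mem_sdiff.1 this).2 ht

lemma HasMinorOn.cone {p : ℕ} {C : Finset V} (h : HasMinorOn G W p) (hC : ConnOn G C)
    (hd : Disjoint C W) (hadj : ∀ v ∈ W, ∃ c ∈ C, G.Adj c v) (hW : W ⊆ W') (hCW : C ⊆ W') :
    HasMinorOn G W' (p + 1) := by
  obtain ⟨f, hf, hc, hdf, ha⟩ := h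
  have hCf : ∀ i, Disjoint C (f i) := fun i => hd.mono_right (hf i)
  have haf : ∀ i, ∃ u ∈ C, ∃ v ∈ f i, G.Adj u v := fun i => by
    obtain ⟨v, hv⟩ := (hc i).1
    obtain ⟨c, hc', hcv⟩ := hadj v (hf i hv)
    exact ⟨c, hc', v, hv, hcv⟩
  refine ⟨Fin.cons C f, ?_, ?_, ?_, ?_⟩
  · intro i
    refine Fin.cases ?_ (fun i => ?_) i
    · simpa using hCW
    · simpa using (hf i).trans hW
  · intro i
    refine Fin.cases ?_ (fun i => ?_) i
    · simpa using hC
    · simpa using hc i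
  · intro i j
    refine Fin.cases ?_ (fun i => ?_) i <;> refine Fin.cases ?_ (fun j => ?_) j
    · simp
    · intro _
      simpa using hCf j
    · intro _
      simpa using (hCf i).symm
    · intro hij
      simpa using hdf i j (fun h => hij (by rw [h]))
  · intro i j
    refine Fin.cases ?_ (fun i => ?_) i <;> refine Fin.cases ?_ (fun j => ?_) j
    · simp
    · intro _
      simpa using haf j
    · intro _
      obtain ⟨u, hu, v, hv, huv⟩ := haf i
      exact ⟨v, by simpa using hv, u, by simpa using hu, huv.symm⟩
    · intro hij
      simpa using ha i j (fun h => hij (by rw [h]))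

lemma HasMinorOn.insert {p : ℕ} {v : V} (h : HasMinorOn G W p) (hv : ∀ w ∈ W, G.Adj v w)
    (hW : W ⊆ W') (hvW : v ∈ W') : HasMinorOn G W' (p + 1) :=
  h.cone (connOn_singleton v)
    (disjoint_singleton_left.2 fun hvW => G.irrefl (hv v hvW))
    (fun w hw => ⟨v, mem_singleton_self v, hv w hw⟩) hW (singleton_subset_iff.2 hvW)

lemma hasMinorOn_of_clique {p : ℕ} (hp : p ≤ #S) (hS : ∀ u ∈ S, ∀ v ∈ S, u ≠ v → G.Adj u v) :
    HasMinorOn G S p := by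
  induction p generalizing S with
  | zero => exact ⟨fun i => i.elim0, fun i => i.elim0, fun i => i.elim0, fun i => i.elim0,
      fun i => i.elim0⟩
  | succ p ih =>
    obtain ⟨v, hv⟩ := card_pos.1 (by omega : 0 < #S)
    have h1 : HasMinorOn G (S.erase v) p := ih (by rw [card_erase_of_mem hv]; omega)
      fun u hu w hw => hS u (mem_of_mem_erase hu) w (mem_of_mem_erase hw)
    exact h1.insert (fun w hw => hS v hv w (mem_of_mem_erase hw) (ne_of_mem_erase hw).symm)
      (erase_subset _ _) hv

lemma dens_eq_sum : dens G W = ∑ v ∈ W, #(nb G W v) := by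
  simp only [dens, nb, card_filter, sum_product]

lemma dens_erase {y : V} (hy : y ∈ W) : dens G W = dens G (W.erase y) + 2 * #(nb G W y) := by
  have h1 : ∀ v ∈ W.erase y, #(nb G W v) = #(nb G (W.erase y) v) + if G.Adj v y then 1 else 0 := by
    intro v _
    simp only [nb, card_filter]
    rw [← add_sum_erase _ _ hy, add_comm]
  have h2 : #(nb G W y) = ∑ v ∈ W.erase y, if G.Adj v y then 1 else 0 := by
    simp only [nb, card_filter]
    rw [← add_sum_erase _ _ hy]
    simp [G.adj_comm y]
  rw [dens_eq_sum, dens_eq_sum, ← add_sum_erase _ _ hy, sum_congr rfl h1, sum_add_distrib, ← h2]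
  ring

lemma even_dens (G : SimpleGraph V) (W : Finset V) : Even (dens G W) := by
  induction W using Finset.induction_on with
  | empty => simp [dens]
  | insert v W hv ih =>
    rw [dens_erase (mem_insert_self v W), erase_insert hv]
    exact ih.add (even_two_mul _)

/-- Contraction of `y` onto `x`; afterwards `y` is isolated. -/
def contract (G : SimpleGraph V) (x y : V) : SimpleGraph V where
  Adj u v := u ≠ v ∧ u ≠ y ∧ v ≠ y ∧ (G.Adj u v ∨ (u = x ∧ G.Adj y v) ∨ (v = x ∧ G.Adj y u))
  symm := ⟨fun u v h => ⟨h.1.symm, h.2.2.1, h.2.1, by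
    rcases h.2.2.2 with h | h | h
    · exact Or.inl h.symm
    · exact Or.inr (Or.inr h)
    · exact Or.inr (Or.inl h)⟩⟩
  loopless := ⟨fun u h => h.1 rfl⟩

lemma dens_contract {x y : V} (hx : x ∈ W) (hy : y ∈ W) (hxy : G.Adj x y) :
    dens G W ≤ dens (contract G x y) (W.erase y) + 2 + 2 * #(nb G W x ∩ nb G W y) := by
  let R := nb G W y \ insert x (nb G W x)
  have hR : ∀ v ∈ R, v ∈ W ∧ G.Adj y v ∧ v ≠ x ∧ ¬ G.Adj x v := fun v hv => by
    simp only [R, mem_sdiff, mem_insert, mem_nb, not_or, not_and] at hv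
    exact ⟨hv.1.1, hv.1.2, hv.2.1, hv.2.2 hv.1.1⟩
  have hdeg : #(nb G W y) ≤ 1 + #(nb G W x ∩ nb G W y) + #R := by
    have : nb G W y ⊆ {x} ∪ (nb G W x ∩ nb G W y) ∪ R := fun v hv => by
      simp only [R, mem_union, mem_sdiff, mem_insert, mem_inter, mem_singleton]
      tauto
    refine (card_le_card this).trans ((card_union_le _ _).trans ?_)
    gcongr
    exact (card_union_le _ _).trans (by simp)
  have hne : x ≠ y := hxy.ne
  let P1 : Finset (V × V) := {p ∈ (W.erase y) ×ˢ (W.erase y) | G.Adj p.1 p.2}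
  let P2 := R.image fun v => (x, v)
  let P3 := R.image fun v => (v, x)
  have hsub : P1 ∪ P2 ∪ P3 ⊆
      {p ∈ (W.erase y) ×ˢ (W.erase y) | (contract G x y).Adj p.1 p.2} := by
    intro p hp
    simp only [P1, P2, P3, mem_union, mem_filter, mem_product, mem_erase, mem_image] at hp ⊢
    rcases hp with (hp | ⟨v, hv, rfl⟩) | ⟨v, hv, rfl⟩
    · exact ⟨hp.1, hp.2.ne, hp.1.1.1, hp.1.2.1, Or.inl hp.2⟩
    · obtain ⟨h1, h2, h3, h4⟩ := hR v hv
      exact ⟨⟨⟨hne, hx⟩, h2.ne', h1⟩, h3.symm, hne, h2.ne', Or.inr (Or.inl ⟨rfl, h2⟩)⟩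
    · obtain ⟨h1, h2, h3, h4⟩ := hR v hv
      exact ⟨⟨⟨h2.ne', h1⟩, hne, hx⟩, h3, h2.ne', hne, Or.inr (Or.inr ⟨rfl, h2⟩)⟩
  have hd12 : Disjoint P1 P2 := by
    rw [Finset.disjoint_left]
    intro p hp hp'
    simp only [P1, P2, mem_filter, mem_image] at hp hp'
    obtain ⟨v, hv, rfl⟩ := hp'
    exact (hR v hv).2.2.2 hp.2
  have hd3 : Disjoint (P1 ∪ P2) P3 := by
    rw [Finset.disjoint_left]
    intro p hp hp'
    simp only [P1, P2, P3, mem_union, mem_filter, mem_image] at hp hp'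
    obtain ⟨v, hv, rfl⟩ := hp'
    rcases hp with hp | ⟨w, hw, h⟩
    · exact (hR v hv).2.2.2 hp.2.symm
    · exact (hR v hv).2.2.1 (Prod.ext_iff.1 h).1.symm
  have hc := card_le_card hsub
  rw [card_union_of_disjoint hd3, card_union_of_disjoint hd12,
    card_image_of_injective _ (fun a b h => (Prod.ext_iff.1 h).2),
    card_image_of_injective _ (fun a b h => (Prod.ext_iff.1 h).1)] at hc
  have h1 : dens G (W.erase y) = #P1 := rfl
  have h2 : dens (contract G x y) (W.erase y) =
    #{p ∈ (W.erase y) ×ˢ (W.erase y) | (contract G x y).Adj p.1 p.2} := rfl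
  rw [dens_erase hy]
  omega

lemma HasMinorOn.of_contract {x y : V} {p : ℕ} (hy : y ∈ W) (hxy : G.Adj x y)
    (h : HasMinorOn (contract G x y) (W.erase y) p) : HasMinorOn G W p := by
  obtain ⟨f, hf, hc, hd, ha⟩ := h
  have hyf : ∀ i, y ∉ f i := fun i hi => (mem_erase.1 (hf i hi)).1 rfl
  let g : Fin p → Finset V := fun i => if x ∈ f i then Insert.insert y (f i) else f i
  have hfg : ∀ i, f i ⊆ g i := fun i => by
    by_cases h : x ∈ f i
    · simp only [g, h, if_true]; exact subset_insert _ _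
    · simp [g, h]
  have hg : ∀ i, ∀ z ∈ g i, z ∈ f i ∨ (z = y ∧ x ∈ f i) := fun i z hz => by
    by_cases h : x ∈ f i
    · simp only [g, h, if_true, mem_insert] at hz; tauto
    · simp only [g, h, if_false] at hz; exact Or.inl hz
  have hyg : ∀ i, x ∈ f i → y ∈ g i := fun i h => by simp [g, h]
  refine ⟨g, fun i z hz => ?_, fun i => ?_, fun i j hij => ?_, fun i j hij => ?_⟩
  · rcases hg i z hz with h | ⟨rfl, -⟩
    · exact mem_of_mem_erase (hf i h)
    · exact hy
  · refine ⟨(hc i).1.mono (hfg i), fun T hT hne hcl => ?_⟩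
    have hyT : x ∈ f i → y ∈ T → x ∈ T := fun hxi hyT => hcl y hyT x (hfg i hxi) hxy.symm
    have hxT : x ∈ T → x ∈ f i → y ∈ T := fun hxT hxi => hcl x hxT y (hyg i hxi) hxy
    have hfT : f i ⊆ T := by
      intro z hz
      have := (hc i).2 (T ∩ f i) inter_subset_right (by
        obtain ⟨t, ht⟩ := hne
        rcases hg i t (hT ht) with h | ⟨rfl, hxi⟩
        · exact ⟨t, mem_inter.2 ⟨ht, h⟩⟩
        · exact ⟨x, mem_inter.2 ⟨hyT hxi ht, hxi⟩⟩) (fun u hu v hv huv => by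
          obtain ⟨huT, hui⟩ := mem_inter.1 hu
          refine mem_inter.2 ⟨?_, hv⟩
          rcases huv.2.2.2 with h | ⟨rfl, h⟩ | ⟨rfl, h⟩
          · exact hcl u huT v (hfg i hv) h
          · exact hcl y (hxT huT hui) v (hfg i hv) h
          · exact hyT hv (hcl u huT y (hyg i hv) h.symm)) hz
      exact (mem_inter.1 this).1
    intro z hz
    rcases hg i z hz with h | ⟨rfl, hxi⟩
    · exact hfT h
    · exact hxT (hfT hxi) hxi
  · rw [Finset.disjoint_left]
    have hdis := Finset.disjoint_left.1 (hd i j hij)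
    intro z hzi hzj
    rcases hg i z hzi with h | ⟨rfl, hxi⟩ <;> rcases hg j z hzj with h' | ⟨h'', hxj⟩
    · exact hdis h h'
    · exact hyf i (h'' ▸ h)
    · exact hyf j h'
    · exact hdis hxi hxj
  · obtain ⟨u, hu, v, hv, huv⟩ := ha i j hij
    rcases huv.2.2.2 with h | ⟨rfl, h⟩ | ⟨rfl, h⟩
    · exact ⟨u, hfg i hu, v, hfg j hv, h⟩
    · exact ⟨y, hyg i hu, v, hfg j hv, h⟩
    · exact ⟨u, hfg i hu, y, hyg j hv, h.symm⟩

lemma card_nb_le {v : V} (hv : v ∈ W) : #(nb G W v) ≤ #W - 1 := by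
  rw [← card_erase_of_mem hv]
  exact card_le_card fun u hu => mem_erase.2 ⟨(mem_nb.1 hu).2.ne', nb_subset hu⟩

lemma dens_le (G : SimpleGraph V) (W : Finset V) : dens G W ≤ #W * (#W - 1) := by
  rw [dens_eq_sum, ← smul_eq_mul]
  exact sum_le_card_nsmul _ _ _ fun v hv => card_nb_le hv

lemma dens_deleteEdges {x y : V} (hx : x ∈ W) (hy : y ∈ W) (hxy : G.Adj x y) :
    dens G W ≤ dens (G.deleteEdges {s(x, y)}) W + 2 ∧
      dens (G.deleteEdges {s(x, y)}) W < dens G W := by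
  have hadj : ∀ u v, (G.deleteEdges {s(x, y)}).Adj u v ↔ G.Adj u v ∧ s(u, v) ≠ s(x, y) := by
    simp
  generalize G.deleteEdges {s(x, y)} = G' at hadj
  constructor
  · have : ({p ∈ W ×ˢ W | G.Adj p.1 p.2} : Finset (V × V)) ⊆
        {p ∈ W ×ˢ W | G'.Adj p.1 p.2} ∪ {(x, y), (y, x)} := by
      rintro ⟨u, v⟩ hp
      simp only [mem_filter, mem_union, mem_insert, mem_singleton, hadj, ne_eq, Sym2.eq_iff,
        Prod.mk.injEq] at hp ⊢
      tauto
    exact (card_le_card this).trans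
      ((card_union_le _ _).trans (Nat.add_le_add_left card_le_two _))
  · refine card_lt_card ((ssubset_iff_of_subset fun p hp => ?_).2 ⟨(x, y), ?_, ?_⟩)
    · simp only [mem_filter, hadj] at hp ⊢
      exact ⟨hp.1, hp.2.1⟩
    · simp [hx, hy, hxy]
    · simp [hadj]

/-- The properties of a minor-minimal graph among those with at least `m` vertices and at least
`a * n - c` edges that do not follow from the number of edges alone. -/
structure Reduced (a c m : ℕ) (G : SimpleGraph V) (W : Finset V) : Prop where
  card_le : m ≤ #W
  triangles : ∀ u ∈ W, ∀ v ∈ W, G.Adj u v → a ≤ #(nb G W u ∩ nb G W v)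
  nonempty : ∀ u ∈ W, (nb G W u).Nonempty
  sparse : ∀ T ⊂ W, m ≤ #T → dens G T + 2 * c < 2 * a * #T
  dens_lt : dens G W < 2 * a * #W

lemma hasMinorOn_of_dens {a c m p : ℕ} (hbase : m * (m - 1) + 2 * c < 2 * a * m) (hc : 1 ≤ c)
    (hred : ∀ (G : SimpleGraph V) (W : Finset V), Reduced a c m G W → HasMinorOn G W p) :
    ∀ (n d : ℕ) (G : SimpleGraph V) (W : Finset V), #W = n → dens G W = d → m ≤ #W →
      2 * a * #W ≤ dens G W + 2 * c → HasMinorOn G W p := by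
  intro n
  induction n using Nat.strong_induction_on with
  | _ n ihn =>
  intro d
  induction d using Nat.strong_induction_on with
  | _ d ihd =>
  intro G W hn hd hm hW
  by_contra hno
  have hmW : m < #W := by
    refine lt_of_le_of_ne hm fun h => ?_
    have := dens_le G W
    rw [← h] at this hW
    omega
  have herase : ∀ y ∈ W, #(W.erase y) < #W ∧ m ≤ #(W.erase y) ∧
      2 * a * #W = 2 * a * #(W.erase y) + 2 * a := fun y hy => by
    have h := card_erase_add_one hy
    refine ⟨by omega, by omega, ?_⟩
    rw [← h]
    ring
  refine hno (hred G W ⟨hm, ?_, ?_, ?_, ?_⟩)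
  · intro u hu v hv huv
    by_contra! hlt
    obtain ⟨h1, h2, h3⟩ := herase v hv
    have h4 := dens_contract hu hv huv
    exact hno (HasMinorOn.of_contract hv huv
      (ihn _ (hn ▸ h1) _ (contract G u v) (W.erase v) rfl rfl h2 (by omega)))
  · intro u hu
    by_contra hne
    rw [not_nonempty_iff_eq_empty] at hne
    obtain ⟨h1, h2, h3⟩ := herase u hu
    have h4 := dens_erase (G := G) hu
    rw [hne, card_empty] at h4
    exact hno ((ihn _ (hn ▸ h1) _ G (W.erase u) rfl rfl h2 (by omega)).mono (erase_subset _ _))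
  · intro T hT hmT
    by_contra! hle
    exact hno ((ihn _ (hn ▸ card_lt_card hT) _ G T rfl rfl hmT hle).mono hT.1)
  · by_contra! hle
    have hpos : 0 < 2 * a * #W := by
      have h1 : 0 < 2 * a * m := by omega
      exact h1.trans_le (Nat.mul_le_mul_left _ hm)
    obtain ⟨⟨x, y⟩, hxy⟩ := card_pos.1 (hpos.trans_le hle)
    simp only [mem_filter, mem_product] at hxy
    obtain ⟨h1, h2⟩ := dens_deleteEdges hxy.1.1 hxy.1.2 hxy.2
    exact hno ((ihd _ (hd ▸ h2) _ W hn rfl hm (by omega)).mono_graph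
      (SimpleGraph.deleteEdges_le _))

namespace Reduced

variable {a c m : ℕ}

lemma card_nb (h : Reduced a c m G W) {v : V} (hv : v ∈ W) : a + 1 ≤ #(nb G W v) := by
  obtain ⟨u, hu⟩ := h.nonempty v hv
  obtain ⟨huW, hvu⟩ := mem_nb.1 hu
  have h1 := h.triangles v hv u huW hvu
  have h2 : insert u (nb G W v ∩ nb G W u) ⊆ nb G W v :=
    insert_subset hu inter_subset_left
  have h3 := card_le_card h2
  rw [card_insert_of_notMem (fun hm => G.irrefl (mem_nb.1 (mem_inter.1 hm).2).2)] at h3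
  omega

lemma card_nb_nb (h : Reduced a c m G W) {v u : V} (hv : v ∈ W) (hu : u ∈ nb G W v) :
    a ≤ #(nb G (nb G W v) u) := by
  obtain ⟨huW, hvu⟩ := mem_nb.1 hu
  have h1 := h.triangles v hv u huW hvu
  refine h1.trans (card_le_card fun z hz => ?_)
  simp only [mem_inter, mem_nb] at hz ⊢
  exact ⟨hz.1, hz.2.2⟩

lemma exists_low (h : Reduced a c m G W) : ∃ v ∈ W, #(nb G W v) < 2 * a := by
  by_contra! hall
  have h1 := card_nsmul_le_sum W _ _ hall
  rw [← dens_eq_sum, smul_eq_mul, mul_comm] at h1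
  exact absurd h.dens_lt (by omega)

end Reduced

lemma hasMinorOn_of_nb {v : V} {p : ℕ} (hv : v ∈ W)
    (hp : HasMinorOn G (nb G W v) p) : HasMinorOn G W (p + 1) :=
  hp.insert (fun _ hu => (mem_nb.1 hu).2) nb_subset hv

lemma isClique_of_card_nb {p : ℕ} (hS : #S ≤ p + 1) (h : ∀ v ∈ S, p ≤ #(nb G S v)) :
    ∀ u ∈ S, ∀ v ∈ S, u ≠ v → G.Adj u v := by
  intro u hu v hv huv
  have h1 : nb G S u ⊆ S.erase u := fun z hz =>
    mem_erase.2 ⟨(mem_nb.1 hz).2.ne', nb_subset hz⟩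
  have h2 := eq_of_subset_of_card_le h1 (by
    rw [card_erase_of_mem hu]
    have := h u hu
    omega)
  exact (mem_nb.1 (h2 ▸ mem_erase.2 ⟨huv.symm, hv⟩ : v ∈ nb G S u)).2

lemma hasMinorOn_four (hW : 2 ≤ #W) (hd : 4 * #W ≤ dens G W + 4) : HasMinorOn G W 4 := by
  refine hasMinorOn_of_dens (a := 2) (c := 2) (m := 2) (by norm_num) (by norm_num)
    (fun G W h => ?_) _ _ G W rfl rfl hW (by omega)
  obtain ⟨v, hv, hlow⟩ := h.exists_low
  have h1 := h.card_nb hv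
  exact hasMinorOn_of_nb hv (hasMinorOn_of_clique (by omega)
    (isClique_of_card_nb (p := 2) (by omega) fun u hu => h.card_nb_nb hv hu))

lemma le_dens {q : ℕ} (h : ∀ v ∈ S, q ≤ #(nb G S v)) : q * #S ≤ dens G S := by
  rw [dens_eq_sum, mul_comm, ← smul_eq_mul]
  exact card_nsmul_le_sum _ _ _ h

lemma hasMinorOn_five (hW : 3 ≤ #W) (hd : 6 * #W ≤ dens G W + 10) : HasMinorOn G W 5 := by
  refine hasMinorOn_of_dens (a := 3) (c := 5) (m := 3) (by norm_num) (by norm_num)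
    (fun G W h => ?_) _ _ G W rfl rfl hW (by omega)
  obtain ⟨v, hv, hlow⟩ := h.exists_low
  have h1 := h.card_nb hv
  have h2 := le_dens fun u hu => h.card_nb_nb hv hu
  obtain ⟨e, he⟩ := even_dens G (nb G W v)
  exact hasMinorOn_of_nb hv (hasMinorOn_four (by omega) (by omega))

namespace Reduced

/-- In a component of the complement of a closed neighbourhood that does not attach to the whole
neighbourhood there is a vertex of small degree. -/
lemma exists_low_mem (h : Reduced 5 13 4 G W) {x : V} {L : Finset V} (hx : x ∈ W)
    (hlow : #(nb G W x) < 10) (hLW : L ⊆ W) (hne : L.Nonempty) (hLx : ∀ z ∈ L, z ≠ x ∧ ¬ G.Adj x z)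
    (hcl : ∀ u ∈ L, ∀ v ∈ W, G.Adj u v → v ∈ L ∨ G.Adj x v)
    (hnot : ∃ v ∈ nb G W x, ∀ u ∈ L, ¬ G.Adj v u) : ∃ y ∈ L, #(nb G W y) < 10 := by
  by_contra! hall
  obtain ⟨v₀, hv₀, hv₀L⟩ := hnot
  let S : Finset V := {v ∈ nb G W x | ∃ u ∈ L, G.Adj v u}
  have hS : ∀ v, v ∈ S ↔ (v ∈ W ∧ G.Adj x v) ∧ ∃ u ∈ L, G.Adj v u := fun v => by
    simp [S, mem_nb]
  have hScard : #S ≤ 8 := by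
    have : S ⊂ nb G W x := (ssubset_iff_of_subset (filter_subset _ _)).2 ⟨v₀, hv₀, fun hv => by
      obtain ⟨-, u, hu, hvu⟩ := (hS v₀).1 hv
      exact hv₀L u hu hvu⟩
    have := card_lt_card this
    omega
  have hLS : Disjoint L S := Finset.disjoint_left.2 fun z hz hz' =>
    (hLx z hz).2 ((hS z).1 hz').1.2
  have hxLS : x ∉ L ∪ S := fun hx' => by
    rcases mem_union.1 hx' with h' | h'
    · exact (hLx x h').1 rfl
    · exact G.irrefl ((hS x).1 h').1.2
  have hnbL : ∀ u ∈ L, ∀ v ∈ W, G.Adj u v → v ∈ L ∪ S := fun u hu v hv huv => by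
    rcases hcl u hu v hv huv with h' | h'
    · exact mem_union_left _ h'
    · exact mem_union_right _ ((hS v).2 ⟨⟨hv, h'⟩, u, hu, huv.symm⟩)
  let B : Finset V := insert x (L ∪ S)
  have hB : L ∪ S ⊆ B := subset_insert _ _
  have hBcard : #B = #L + #S + 1 := by
    rw [card_insert_of_notMem hxLS, card_union_of_disjoint hLS]
  have hBW : B ⊂ W := by
    refine (ssubset_iff_of_subset ?_).2 ⟨v₀, nb_subset hv₀, fun hv => ?_⟩
    · exact insert_subset hx (union_subset hLW ((filter_subset _ _).trans nb_subset))
    · rcases mem_insert.1 hv with rfl | hv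
      · exact G.irrefl (mem_nb.1 hv₀).2
      · rcases mem_union.1 hv with hv | hv
        · exact (hLx v₀ hv).2 (mem_nb.1 hv₀).2
        · obtain ⟨-, u, hu, hvu⟩ := (hS v₀).1 hv
          exact hv₀L u hu hvu
  have hdL : ∀ u ∈ L, 10 ≤ #(nb G B u) := fun u hu =>
    (hall u hu).trans (card_le_card fun z hz => by
      obtain ⟨hzW, huz⟩ := mem_nb.1 hz
      exact mem_nb.2 ⟨hB (hnbL u hu z hzW huz), huz⟩)
  have hdS : ∀ v ∈ S, 7 ≤ #(nb G B v) := fun v hv => by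
    obtain ⟨⟨hvW, hxv⟩, w, hw, hvw⟩ := (hS v).1 hv
    have h1 := h.triangles v hvW w (hLW hw) hvw
    have h2 : w ∉ nb G W v ∩ nb G W w := fun h' => G.irrefl (mem_nb.1 (mem_inter.1 h').2).2
    have h3 : x ∉ insert w (nb G W v ∩ nb G W w) := fun h' => by
      rcases mem_insert.1 h' with h' | h'
      · exact (hLx w hw).1 h'.symm
      · exact (hLx w hw).2 (mem_nb.1 (mem_inter.1 h').2).2.symm
    have h4 : insert x (insert w (nb G W v ∩ nb G W w)) ⊆ nb G B v := by
      refine insert_subset (mem_nb.2 ⟨mem_insert_self _ _, hxv.symm⟩)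
        (insert_subset (mem_nb.2 ⟨hB (mem_union_left _ hw), hvw⟩) fun z hz => ?_)
      simp only [mem_inter, mem_nb] at hz
      exact mem_nb.2 ⟨hB (hnbL w hw z hz.1.1 hz.2.2), hz.1.2⟩
    have h5 := card_le_card h4
    rw [card_insert_of_notMem h3, card_insert_of_notMem h2] at h5
    omega
  have hdx : #S ≤ #(nb G B x) := card_le_card fun z hz =>
    mem_nb.2 ⟨hB (mem_union_right _ hz), ((hS z).1 hz).1.2⟩
  have hdens : #S + (10 * #L + 7 * #S) ≤ dens G B := by
    rw [dens_eq_sum, sum_insert hxLS, sum_union hLS]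
    have h1 := card_nsmul_le_sum L _ _ hdL
    have h2 := card_nsmul_le_sum S _ _ hdS
    simp only [smul_eq_mul] at h1 h2
    omega
  obtain ⟨u, hu⟩ := hne
  have h4 : 4 ≤ #B := by
    have := (hdL u hu).trans (card_le_card nb_subset)
    omega
  have := h.sparse B hBW h4
  omega

/-- Some vertex `y` of small degree has a connected set outside its closed neighbourhood that
attaches to every neighbour of `y` which is not adjacent to all other neighbours of `y`. -/
lemma exists_attached (h : Reduced 5 13 4 G W)
    (hx : ∃ x ∈ W, #(nb G W x) < 10 ∧ ∃ z ∈ W, z ≠ x ∧ ¬ G.Adj x z) :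
    ∃ y ∈ W, #(nb G W y) < 10 ∧ ∃ K ⊆ W, ConnOn G K ∧ (∀ z ∈ K, z ≠ y ∧ ¬ G.Adj y z) ∧
      ∀ v ∈ nb G W y, (∃ u ∈ nb G W y, u ≠ v ∧ ¬ G.Adj v u) → ∃ k ∈ K, G.Adj v k := by
  by_contra! hcon
  let far : V → Finset V := fun x => {z ∈ W | z ≠ x ∧ ¬ G.Adj x z}
  have hfar : ∀ x z, z ∈ far x ↔ z ∈ W ∧ z ≠ x ∧ ¬ G.Adj x z := fun x z => by simp [far]
  have hcomp : ∀ x z, z ∈ far x → ∃ L ⊆ W, z ∈ L ∧ ConnOn G L ∧ (∀ z ∈ L, z ≠ x ∧ ¬ G.Adj x z) ∧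
      ∀ u ∈ L, ∀ v ∈ W, G.Adj u v → v ∈ L ∨ G.Adj x v := fun x z hz => by
    obtain ⟨L, hL, hzL, hconn, hcl⟩ := exists_component G hz
    refine ⟨L, fun u hu => ((hfar x u).1 (hL hu)).1, hzL, hconn,
      fun u hu => ((hfar x u).1 (hL hu)).2, fun u hu v hv huv => ?_⟩
    by_cases hxv : G.Adj x v
    · exact Or.inr hxv
    · refine Or.inl (hcl u hu v ((hfar x v).2 ⟨hv, ?_, hxv⟩) huv)
      rintro rfl
      exact ((hfar v u).1 (hL hu)).2.2 huv.symm
  let P : ℕ → Prop := fun n => ∃ x ∈ W, #(nb G W x) < 10 ∧ ∃ L ⊆ W, #L = n ∧ ConnOn G L ∧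
    (∀ z ∈ L, z ≠ x ∧ ¬ G.Adj x z) ∧ ∀ u ∈ L, ∀ v ∈ W, G.Adj u v → v ∈ L ∨ G.Adj x v
  have hP : ∃ n, P n := by
    obtain ⟨x, hxW, hlow, z, hz⟩ := hx
    obtain ⟨L, hLW, -, hconn, hLx, hcl⟩ := hcomp x z ((hfar x z).2 hz)
    exact ⟨_, x, hxW, hlow, L, hLW, rfl, hconn, hLx, hcl⟩
  obtain ⟨x, hxW, hlow, L, hLW, hLn, hconn, hLx, hcl⟩ := Nat.find_spec hP
  have hmin : ∀ n, P n → #L ≤ n := fun n hn => hLn ▸ Nat.find_min' hP hn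
  have hy : ∃ y ∈ L, #(nb G W y) < 10 := by
    obtain ⟨v, hv, -, hvL⟩ := hcon x hxW hlow L hLW hconn hLx
    exact h.exists_low_mem hxW hlow hLW hconn.1 hLx hcl ⟨v, hv, hvL⟩
  obtain ⟨y, hyL, hymin⟩ := exists_min_image L (fun y => #(nb G W y)) hconn.1
  have hylow : #(nb G W y) < 10 := by
    obtain ⟨z, hz, hz'⟩ := hy
    exact (hymin z hz).trans_lt hz'
  have hxy : x ∈ far y := (hfar y x).2
    ⟨hxW, (hLx y hyL).1.symm, fun h' => (hLx y hyL).2 h'.symm⟩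
  obtain ⟨K, hKW, hxK, hKconn, hKy, hKcl⟩ := hcomp y x hxy
  obtain ⟨v, hv, ⟨u, hu, huv, hvu⟩, hvK⟩ := hcon y (hLW hyL) hylow K hKW hKconn hKy
  obtain ⟨hvW, hyv⟩ := mem_nb.1 hv
  have hvL : v ∈ L := by
    rcases hcl y hyL v hvW hyv with h' | h'
    · exact h'
    · exact absurd h'.symm (hvK x hxK)
  obtain ⟨w, hw, hwy, hyw⟩ : ∃ w ∈ nb G W v, w ≠ y ∧ ¬ G.Adj y w := by
    by_contra! hall
    have hsub : nb G W v ⊆ insert y (((nb G W y).erase v).erase u) := fun w hw => by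
      obtain ⟨hwW, hvw⟩ := mem_nb.1 hw
      by_cases hwy : w = y
      · exact hwy ▸ mem_insert_self _ _
      · refine mem_insert_of_mem (mem_erase.2 ⟨?_, mem_erase.2 ⟨hvw.ne', ?_⟩⟩)
        · rintro rfl
          exact hvu hvw
        · exact mem_nb.2 ⟨hwW, hall w hw hwy⟩
    have h1 := (card_le_card hsub).trans (card_insert_le _ _)
    have h2 := card_erase_add_one (mem_erase.2 ⟨huv, hu⟩)
    have h3 := card_erase_add_one hv
    have h4 := hymin v hvL
    omega
  obtain ⟨hwW, hvw⟩ := mem_nb.1 hw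
  obtain ⟨L', hL'W, hwL', hL'conn, hL'y, hL'cl⟩ := hcomp y w ((hfar y w).2 ⟨hwW, hwy, hyw⟩)
  have hwK : w ∉ K := fun h' => hvK w h' hvw
  have hdisj : ∀ z ∈ L', z ∉ K := fun z hz hzK => by
    have : L' ⊆ L' ∩ K := hL'conn.2 (L' ∩ K) inter_subset_left ⟨z, mem_inter.2 ⟨hz, hzK⟩⟩
      fun a ha b hb hab => mem_inter.2 ⟨hb, (hKcl a (mem_inter.1 ha).2 b (hL'W hb) hab).resolve_right
        (hL'y b hb).2⟩
    exact hwK (mem_inter.1 (this hwL')).2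
  have hL'x : ∀ z ∈ L', ¬ G.Adj x z := fun z hz hxz =>
    hdisj z hz ((hKcl x hxK z (hL'W hz) hxz).resolve_right (hL'y z hz).2)
  have hwL : w ∈ L := (hcl v hvL w hwW hvw).resolve_right (hL'x w hwL')
  have hL'L : L' ⊆ L := by
    have : L' ⊆ L' ∩ L := hL'conn.2 (L' ∩ L) inter_subset_left ⟨w, mem_inter.2 ⟨hwL', hwL⟩⟩
      fun a ha b hb hab => mem_inter.2 ⟨hb, (hcl a (mem_inter.1 ha).2 b (hL'W hb) hab).resolve_right
        (hL'x b hb)⟩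
    exact fun z hz => (mem_inter.1 (this hz)).2
  have hlt : #L' < #L := card_lt_card
    ((ssubset_iff_of_subset hL'L).2 ⟨y, hyL, fun h' => (hL'y y h').1 rfl⟩)
  have := hmin _ ⟨y, hLW hyL, hylow, L', hL'W, rfl, hL'conn, hL'y, hL'cl⟩
  omega

end Reduced

lemma exists_not_adj_of_card_nb {v : V} (h : #(nb G S v) + 1 < #S) :
    ∃ u ∈ S, u ≠ v ∧ ¬ G.Adj v u := by
  by_contra! hall
  have : S ⊆ insert v (nb G S v) := fun u hu => by
    by_cases huv : u = v
    · exact huv ▸ mem_insert_self _ _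
    · exact mem_insert_of_mem (mem_nb.2 ⟨hu, hall u hu huv⟩)
  have := (card_le_card this).trans (card_insert_le _ _)
  omega

lemma card_nb_of_not_adj {u v : V} (hu : u ∈ S) (hv : v ∈ S) (huv : u ≠ v) (h : ¬ G.Adj v u) :
    #(nb G S v) + 2 ≤ #S := by
  have h1 : nb G S v ⊆ (S.erase v).erase u := fun w hw => by
    obtain ⟨hwS, hvw⟩ := mem_nb.1 hw
    refine mem_erase.2 ⟨?_, mem_erase.2 ⟨hvw.ne', hwS⟩⟩
    rintro rfl
    exact h hvw
  have h2 := card_erase_add_one (mem_erase.2 ⟨huv, hu⟩)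
  have h3 := card_erase_add_one hv
  have h4 := card_le_card h1
  omega

/-- A graph of minimum degree at least `5` on `6` to `9` vertices contains `K_6` as a minor, or
contains `K_5` as a minor after deletion of some vertex that is not adjacent to all others. -/
lemma exists_erase_hasMinorOn_five {H : Finset V} (h6 : 6 ≤ #H) (h9 : #H ≤ 9)
    (hdeg : ∀ v ∈ H, 5 ≤ #(nb G H v)) :
    HasMinorOn G H 6 ∨
      ∃ z ∈ H, (∃ u ∈ H, u ≠ z ∧ ¬ G.Adj z u) ∧ HasMinorOn G (H.erase z) 5 := by
  by_contra! hcon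
  obtain ⟨hno6, hno⟩ := hcon
  obtain ⟨a, ha, b, hb, hab, hnab⟩ : ∃ a ∈ H, ∃ b ∈ H, a ≠ b ∧ ¬ G.Adj a b := by
    by_contra! hall
    exact hno6 (hasMinorOn_of_clique h6 hall)
  have hfew : ∀ z ∈ H, #(nb G H z) + 1 < #H → dens G H + 16 < 6 * #H + 2 * #(nb G H z) := by
    intro z hz hlt
    by_contra! hle
    have h1 := dens_erase (G := G) hz
    have h2 := card_erase_add_one hz
    exact hno z hz (exists_not_adj_of_card_nb hlt) (hasMinorOn_five (by omega) (by omega))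
  obtain ⟨v, hv, hmin⟩ := exists_min_image H (fun y => #(nb G H y)) ⟨a, ha⟩
  have hva := hmin a ha
  have hav := card_nb_of_not_adj hb ha hab.symm hnab
  have h5 := hdeg v hv
  obtain ⟨e, he⟩ := even_dens G H
  have hfv := hfew v hv (by omega)
  have hsum : #(nb G H v) * #H ≤ dens G H := le_dens hmin
  have hv5 : #(nb G H v) = 5 := by
    by_contra hne
    have h1 : 6 * (#H - 2) ≤ #(nb G H v) * (#H - 2) := Nat.mul_le_mul_right _ (by omega)
    rw [Nat.mul_sub, Nat.mul_sub] at h1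
    omega
  rw [hv5] at hsum hfv
  have hdens : dens G H + 8 = 6 * #H := by omega
  let X : Finset V := {z ∈ H | 6 ≤ #(nb G H z)}
  have hX : #X ≤ 1 := by
    have h1 : ∑ z ∈ H, (5 + if 6 ≤ #(nb G H z) then 1 else 0) ≤ ∑ z ∈ H, #(nb G H z) :=
      sum_le_sum fun z hz => by
        have := hdeg z hz
        split_ifs <;> omega
    rw [sum_add_distrib, ← card_filter, ← dens_eq_sum, sum_const, smul_eq_mul] at h1
    change _ + #X ≤ _ at h1
    omega
  have hnotX : ∀ z ∈ H, z ∉ X → #(nb G H z) = 5 := fun z hz hzX => by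
    have h1 := hdeg z hz
    have h2 : ¬ 6 ≤ #(nb G H z) := fun h' => hzX (mem_filter.2 ⟨hz, h'⟩)
    omega
  have hnb4 : ¬ HasMinorOn G (nb G H v) 4 := fun h4 => by
    obtain ⟨u, hu, huv, hvu⟩ := exists_not_adj_of_card_nb (G := G) (S := H) (v := v) (by omega)
    refine hno u hu ⟨v, hv, huv.symm, fun h' => hvu h'.symm⟩ (h4.insert (v := v)
      (fun w hw => (mem_nb.1 hw).2) (fun w hw => mem_erase.2 ⟨?_, nb_subset hw⟩)
      (mem_erase.2 ⟨huv.symm, hv⟩))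
    rintro rfl
    exact hvu (mem_nb.1 hw).2
  obtain ⟨w, hw, hw2⟩ : ∃ w ∈ nb G H v, #(nb G (nb G H v) w) ≤ 2 := by
    by_contra! hall
    have h1 := le_dens (q := 3) hall
    obtain ⟨e', he'⟩ := even_dens G (nb G H v)
    exact hnb4 (hasMinorOn_four (by omega) (by omega))
  obtain ⟨hwH, hvw⟩ := mem_nb.1 hw
  let C := nb G (nb G H v) w
  have hC : ∀ z, z ∈ C ↔ (z ∈ H ∧ G.Adj v z) ∧ G.Adj w z := fun z => by simp [C, mem_nb]
  obtain ⟨z, hzH, hzX, hzv, hzw, hzC⟩ :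
      ∃ z ∈ H, z ∉ X ∧ z ≠ v ∧ z ≠ w ∧ #(C.erase z) ≤ 1 := by
    by_cases hC2 : #C = 2
    · obtain ⟨z, hz⟩ := card_pos.1 (lt_of_lt_of_le (by omega) (le_card_sdiff X C))
      obtain ⟨hzC, hzX⟩ := mem_sdiff.1 hz
      have hz' := (hC z).1 hzC
      exact ⟨z, hz'.1.1, hzX, hz'.1.2.ne', hz'.2.ne', by rw [card_erase_of_mem hzC, hC2]⟩
    · have h1 : #(X ∪ {v, w}) ≤ 3 :=
        (card_union_le _ _).trans (Nat.add_le_add hX card_le_two)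
      obtain ⟨z, hz⟩ := card_pos.1 (lt_of_lt_of_le (by omega) (le_card_sdiff (X ∪ {v, w}) H))
      simp only [mem_sdiff, mem_union, mem_insert, mem_singleton, not_or] at hz
      refine ⟨z, hz.1, hz.2.1, hz.2.2.1, hz.2.2.2, (card_erase_le).trans ?_⟩
      change #C ≤ 2 at hw2
      omega
  have hz5 := hnotX z hzH hzX
  refine hno z hzH (exists_not_adj_of_card_nb (by omega)) ?_
  have hvz : v ∈ H.erase z := mem_erase.2 ⟨hzv.symm, hv⟩
  have hwz : w ∈ H.erase z := mem_erase.2 ⟨hzw.symm, hwH⟩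
  have h1 := dens_contract hvz hwz hvw
  have h2 : #(nb G (H.erase z) v ∩ nb G (H.erase z) w) ≤ 1 :=
    (card_le_card fun u hu => by
      simp only [mem_inter, mem_nb, mem_erase] at hu
      exact mem_erase.2 ⟨hu.1.1.1, (hC u).2 ⟨⟨hu.1.1.2, hu.1.2⟩, hu.2.2⟩⟩).trans hzC
  have h3 := dens_erase (G := G) hzH
  have h4 := card_erase_add_one hzH
  have h5 := card_erase_add_one hwz
  exact HasMinorOn.of_contract hwz hvw (hasMinorOn_five (by omega) (by omega))

lemma Reduced.exists_low_not_adj (h : Reduced 5 13 4 G W) (hno : ¬ HasMinorOn G W 7) :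
    ∃ x ∈ W, #(nb G W x) < 10 ∧ ∃ z ∈ W, z ≠ x ∧ ¬ G.Adj x z := by
  by_contra! hall
  obtain ⟨v, hv, hlow⟩ := h.exists_low
  have h1 : ¬ #(nb G W v) + 1 < #W := fun h' => by
    obtain ⟨u, hu, huv, hvu⟩ := exists_not_adj_of_card_nb h'
    exact hvu (hall v hv (by omega) u hu huv)
  have h2 := h.card_nb hv
  have h3 := card_nb_le (G := G) hv
  refine hno (hasMinorOn_of_clique (by omega) fun a ha b hb hab => ?_)
  exact hall a ha (by have := card_nb_le (G := G) ha; omega) b hb hab.symm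

lemma Reduced.hasMinorOn_seven (h : Reduced 5 13 4 G W) : HasMinorOn G W 7 := by
  by_contra hno
  obtain ⟨y, hy, hlow, K, hKW, hK, hKy, hatt⟩ := h.exists_attached (h.exists_low_not_adj hno)
  have hdeg : ∀ v ∈ nb G W y, 5 ≤ #(nb G (nb G W y) v) := fun v hv => h.card_nb_nb hy hv
  rcases exists_erase_hasMinorOn_five (h.card_nb hy) (by omega) hdeg with h6 | ⟨z, hz, hzu, h5⟩
  · exact hno (hasMinorOn_of_nb hy h6)
  · obtain ⟨k, hk, hzk⟩ := hatt z hz hzu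
    obtain ⟨hzW, hyz⟩ := mem_nb.1 hz
    have h6 : HasMinorOn G (insert y ((nb G W y).erase z)) 6 :=
      h5.insert (fun w hw => (mem_nb.1 (mem_of_mem_erase hw)).2) (subset_insert _ _)
        (mem_insert_self _ _)
    refine hno (h6.cone (hK.insert hk hzk) ?_ (fun u hu => ?_)
      (insert_subset hy ((erase_subset _ _).trans nb_subset)) (insert_subset hzW hKW))
    · rw [Finset.disjoint_left]
      intro u hu hu'
      rcases mem_insert.1 hu' with rfl | hu'
      · rcases mem_insert.1 hu with rfl | hu
        · exact G.irrefl hyz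
        · exact (hKy u hu).1 rfl
      · rcases mem_insert.1 hu with rfl | hu
        · exact (mem_erase.1 hu').1 rfl
        · exact (hKy u hu).2 (mem_nb.1 (mem_of_mem_erase hu')).2
    · rcases mem_insert.1 hu with rfl | hu
      · exact ⟨z, mem_insert_self _ _, hyz.symm⟩
      · obtain ⟨huz, hu⟩ := mem_erase.1 hu
        by_cases hzu' : G.Adj z u
        · exact ⟨z, mem_insert_self _ _, hzu'⟩
        · obtain ⟨k', hk', huk'⟩ := hatt u hu ⟨z, hz, huz.symm, fun h' => hzu' h'.symm⟩
          exact ⟨k', mem_insert_of_mem hk', huk'.symm⟩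

lemma hasMinorOn_seven (hW : 4 ≤ #W) (hd : 10 * #W ≤ dens G W + 26) : HasMinorOn G W 7 :=
  hasMinorOn_of_dens (a := 5) (c := 13) (m := 4) (by norm_num) (by norm_num)
    (fun _ _ h => h.hasMinorOn_seven) _ _ G W rfl rfl hW (by omega)

/-- A non-empty graph without isolated vertices in which every edge lies in at least five
triangles contains `K_7` as a minor. -/
lemma hasMinorOn_seven_of_triangles (hW : W.Nonempty)
    (htri : ∀ u ∈ W, ∀ v ∈ W, G.Adj u v → 5 ≤ #(nb G W u ∩ nb G W v))
    (hne : ∀ u ∈ W, (nb G W u).Nonempty) : HasMinorOn G W 7 := by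
  by_contra hno
  have hcard : 4 ≤ #W := by
    obtain ⟨u, hu⟩ := hW
    obtain ⟨v, hv⟩ := hne u hu
    have h1 := htri u hu v (nb_subset hv) (mem_nb.1 hv).2
    have h2 := card_le_card (inter_subset_left.trans nb_subset : nb G W u ∩ nb G W v ⊆ W)
    omega
  refine hno (Reduced.hasMinorOn_seven ⟨hcard, htri, hne, fun T hT hT4 => ?_, ?_⟩)
  · by_contra hle
    exact hno ((hasMinorOn_seven hT4 (by omega)).mono hT.1)
  · by_contra hle
    exact hno (hasMinorOn_seven hcard (by omega))

lemma colorable_of_add_one_le {n : ℕ} (h : G.chromaticNumber + 1 ≤ n + 1) : G.Colorable n := by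
  rw [← SimpleGraph.chromaticNumber_le_iff_colorable]
  exact (ENat.add_le_add_iff_right (by simp)).1 h

lemma exists_adj_of_colorable_induce {k : ℕ} {v : V} (hk : 1 ≤ k)
    (hv : (G.induce ({v}ᶜ : Set V)).Colorable k) (hG : ¬ G.Colorable k) : ∃ u, G.Adj v u := by
  by_contra! hall
  obtain ⟨c⟩ := hv
  refine hG ⟨SimpleGraph.Coloring.mk
    (fun u => if h : u = v then ⟨0, hk⟩ else c ⟨u, h⟩) ?_⟩
  intro a b hab
  have ha : a ≠ v := by
    rintro rfl
    exact hall b hab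
  have hb : b ≠ v := by
    rintro rfl
    exact hall a hab.symm
  simp only [ha, hb, dif_neg, not_false_eq_true]
  exact c.valid (by simpa using hab)

/-- If a graph with an edge `xy` is not `(k + 1)`-colourable, but is `k`-colourable after deletion
of `x` and `y`, then all colours occur on common neighbours of `x` and `y`. -/
lemma le_card_common_of_colorable [Fintype V] {k : ℕ} {x y : V}
    (h : (G.induce ({x, y}ᶜ : Set V)).Colorable k) (hG : ¬ G.Colorable (k + 1)) :
    k ≤ #(nb G univ x ∩ nb G univ y) := by
  by_contra! hlt
  obtain ⟨c⟩ := h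
  have hmem : ∀ {v}, v ≠ x → v ≠ y → v ∈ ({x, y}ᶜ : Set V) := fun h1 h2 => by simp [h1, h2]
  obtain ⟨i, hi⟩ : ∃ i : Fin k, ∀ v, ∀ h : v ∈ ({x, y}ᶜ : Set V), G.Adj x v → G.Adj y v →
      c ⟨v, h⟩ ≠ i := by
    by_contra! hall
    choose f hf hxf hyf hcf using hall
    have hinj : Function.Injective f := fun i j hij => by
      rw [← hcf i, ← hcf j]
      congr 2
    have := card_le_card_of_injOn (s := (univ : Finset (Fin k)))
      (t := nb G univ x ∩ nb G univ y) f (fun i _ => by simp [mem_nb, hxf i, hyf i]) hinj.injOn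
    rw [card_fin] at this
    omega
  have hcol : G.Coloring (Option (Fin k)) := SimpleGraph.Coloring.mk
    (fun v => if h : v = x then some i else if h' : v = y then none else
      if c ⟨v, hmem h h'⟩ = i ∧ G.Adj x v then none else some (c ⟨v, hmem h h'⟩)) (by
      intro u v huv
      have hval : ∀ hu hv, c ⟨u, hu⟩ ≠ c ⟨v, hv⟩ := fun hu hv => c.valid (by simpa using huv)
      have hcu : ∀ hu, c ⟨u, hu⟩ = i → G.Adj x u → ¬ G.Adj y u := fun hu h1 h2 h3 =>
        hi u hu h2 h3 h1
      have hcv : ∀ hv, c ⟨v, hv⟩ = i → G.Adj x v → ¬ G.Adj y v := fun hv h1 h2 h3 =>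
        hi v hv h2 h3 h1
      have hvu := huv.symm
      have hne := huv.ne
      split_ifs <;> grind)
  have := hcol.colorable
  simp at this
  exact hG this

end CompleteMinor

/-- Every double-critical `k`-chromatic graph with `k ≥ 7` contains `K₇` as a minor. -/
theorem stmt18 {V : Type} [Fintype V] (G : SimpleGraph V) (k : ℕ) (hk : 7 ≤ k)
    (hdc : DoubleCritical G) (hchrom : G.chromaticNumber = k) :
    HasCompleteMinor G 7 := by
  obtain ⟨k, rfl⟩ : ∃ n, k = n + 1 + 1 := ⟨k - 2, by omega⟩
  have hG : ¬ G.Colorable (k + 1) := fun h => by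
    have := SimpleGraph.chromaticNumber_le_iff_colorable.2 h
    rw [hchrom] at this
    norm_cast at this
    omega
  refine CompleteMinor.HasMinorOn.hasCompleteMinor
    (CompleteMinor.hasMinorOn_seven_of_triangles (W := Finset.univ) ?_ ?_ ?_)
  · by_contra hV
    rw [Finset.univ_nonempty_iff, not_nonempty_iff] at hV
    exact hG (SimpleGraph.Colorable.of_isEmpty _)
  · intro x _ y _ hxy
    have h := hdc.2 x y hxy
    rw [hchrom] at h
    have h1 := CompleteMinor.le_card_common_of_colorable (G := G) (x := x) (y := y) (k := k)
      (CompleteMinor.colorable_of_add_one_le (by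
        refine (ENat.add_le_add_iff_right (k := 1) (by simp)).1 ?_
        rw [add_assoc, one_add_one_eq_two]
        exact_mod_cast h)) hG
    exact le_trans (by omega) h1
  · intro v _
    have h := hdc.1 v
    rw [hchrom] at h
    obtain ⟨u, hu⟩ := CompleteMinor.exists_adj_of_colorable_induce (k := k + 1) (by omega)
      (CompleteMinor.colorable_of_add_one_le (Order.add_one_le_of_lt h)) hG
    exact ⟨u, CompleteMinor.mem_nb.2 ⟨Finset.mem_univ u, hu⟩⟩
end
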